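/- arXiv:1401.3702 — 2 statements merged into one kernel-verified Lean document; each statement's English description precedes it below -/
import Mathlib

section
/- Let p > 2 be a prime, q = p^n, and let ℓ ≥ 6 with ℓ ≡ 2 (mod 4); set r = ℓ/2 + 2. Then the pointset K = {(x : y : 1) : x, y ∈ F_{q^ℓ}, T(y) = T(x^{q^r+1})} ∪ {(0:1:0)} is a complete (N, d₁)-arc in PG(2, q^ℓ) with N = q^{2ℓ−1} + 1 and d₁ = q^{ℓ−1} + q^{r−3}; that is, #K = q^{2ℓ−1} + 1, every line of PG(2, q^ℓ) contains at most q^{ℓ−1} + q^{r−3} points of K, and for every point P ∉ K there is a line through P containing exactly q^{ℓ−1} + q^{r−3} points of K. (Note d₁ = q^{ℓ−1} + q^{ℓ/2−1} is strictly smaller than the degree q^{ℓ−1} + q^{r−1} of H.) -/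
theorem AddMonoidHom.card_mul_card_fiber {V k : Type*} [AddGroup V] [AddGroup k] [Finite V]
    (f : V →+ k) (hf : Function.Surjective f) (c : k) :
    Nat.card k * Nat.card {x // f x = c} = Nat.card V := by
  have : Finite k := Finite.of_surjective f hf
  have := Fintype.ofFinite k
  rw [← Nat.card_congr (Equiv.sigmaFiberEquiv f), Nat.card_sigma,
    Finset.sum_congr rfl (g := fun _ => Nat.card {x // f x = c})]
  · simp
  · intro d _
    obtain ⟨u, rfl⟩ := hf d
    obtain ⟨v, rfl⟩ := hf c
    refine Nat.card_congr ((Equiv.addRight (-u + v)).subtypeEquiv fun x => ?_)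
    simp [add_neg_eq_zero]

theorem card_mul_card_pairs_eq_level {V k : Type*} [AddCommGroup V] [AddCommGroup k]
    [Finite V] (Q : V → k) (B : V → V →+ k) (hQ : ∀ y u, Q (y + u) = Q y + B u y + Q u)
    (hB : ∀ u, u ≠ 0 → Function.Surjective (B u)) :
    Nat.card k * Nat.card {z : V × V // Q z.1 = Q z.2} =
      Nat.card k * Nat.card V + (Nat.card V - 1) * Nat.card V := by
  have := Fintype.ofFinite V
  classical
  let e : {z : V × V // Q z.1 = Q z.2} ≃ Σ u : V, {y : V // B u y = -Q u} :=
    { toFun := fun z => ⟨z.1.2 - z.1.1, z.1.1, by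
        have h := hQ z.1.1 (z.1.2 - z.1.1)
        rw [add_sub_cancel, ← z.2, add_assoc, left_eq_add] at h
        exact eq_neg_of_add_eq_zero_left h⟩
      invFun := fun z => ⟨(z.2.1, z.2.1 + z.1), by simp [hQ, z.2.2]⟩
      left_inv := fun z => by simp
      right_inv := fun ⟨u, y, hy⟩ => by
        have : y + u - y = u := by abel
        simp only
        congr! }
  rw [Nat.card_congr e, Nat.card_sigma, Finset.mul_sum,
    ← Finset.add_sum_erase _ _ (Finset.mem_univ 0)]
  congr 1
  · congr 1
    refine Nat.card_congr (Equiv.subtypeUnivEquiv fun y => ?_)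
    have h := hQ y 0
    rw [add_zero, add_assoc, left_eq_add] at h
    exact eq_neg_of_add_eq_zero_left h
  · rw [Finset.sum_congr rfl fun u hu =>
      (B u).card_mul_card_fiber (hB u (Finset.ne_of_mem_erase hu)) (-Q u)]
    simp [Finset.card_erase_of_mem]

/-- A function with nondegenerate polarization and constant nonzero level sizes behaves like a
nondegenerate quadratic form: its level sizes are determined up to one sign. -/
theorem card_level_sub_sq {V k : Type*} [AddCommGroup V] [Field k] [Finite k]
    [Finite V] (Q : V → k) (B : V → V →+ k) (hQ : ∀ y u, Q (y + u) = Q y + B u y + Q u)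
    (hB : ∀ u, u ≠ 0 → Function.Surjective (B u))
    (hc : ∀ c : k, c ≠ 0 → Nat.card {x // Q x = c} = Nat.card {x // Q x = 1}) :
    (Nat.card {x // Q x = 0} + (Nat.card k - 1) * Nat.card {x // Q x = 1} : ℤ) = Nat.card V ∧
    (Nat.card {x // Q x = 0} - Nat.card {x // Q x = 1} : ℤ) ^ 2 = Nat.card V := by
  have := Fintype.ofFinite k
  classical
  have hsum (g : ℕ → ℕ) : ((∑ c : k, g (Nat.card {x // Q x = c}) : ℕ) : ℤ) =
      g (Nat.card {x // Q x = 0}) + (Nat.card k - 1) * g (Nat.card {x // Q x = 1}) := by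
    rw [← Finset.add_sum_erase _ _ (Finset.mem_univ 0),
      Finset.sum_congr rfl fun c hc' => congrArg g (hc c (Finset.ne_of_mem_erase hc'))]
    have : 1 ≤ Fintype.card k := Fintype.card_pos
    simp [Finset.card_erase_of_mem, Nat.cast_sub this]
  have h1 : ∑ c : k, Nat.card {x // Q x = c} = Nat.card V := by
    rw [← Nat.card_sigma, Nat.card_congr (Equiv.sigmaFiberEquiv Q)]
  have h2 : ∑ c : k, Nat.card {x // Q x = c} ^ 2 = Nat.card {z : V × V // Q z.1 = Q z.2} := by
    let e : {z : V × V // Q z.1 = Q z.2} ≃ Σ c : k, {x // Q x = c} × {x // Q x = c} :=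
      { toFun := fun z => ⟨Q z.1.2, ⟨z.1.1, z.2⟩, ⟨z.1.2, rfl⟩⟩
        invFun := fun z => ⟨(z.2.1.1, z.2.2.1), by rw [z.2.1.2, z.2.2.2]⟩
        left_inv := fun z => rfl
        right_inv := by rintro ⟨c, ⟨x, hx⟩, ⟨y, rfl⟩⟩; rfl }
    rw [Nat.card_congr e, Nat.card_sigma]
    simp [sq, Nat.card_prod]
  have h3 := card_mul_card_pairs_eq_level Q B hQ hB
  have e1 := hsum id
  have e2 := hsum (· ^ 2)
  simp only [id, h1, h2] at e1 e2
  refine ⟨e1.symm, ?_⟩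
  have hV : 1 ≤ Nat.card V := Nat.card_pos
  have hk : (1 : ℤ) < Nat.card k := by exact_mod_cast Finite.one_lt_card
  zify [hV] at h3
  rw [e2, e1] at h3
  rw [e1]
  have hk' : (Nat.card k - 1 : ℤ) ≠ 0 := by linarith
  apply mul_left_cancel₀ hk'
  push_cast at h3
  linear_combination h3

theorem sign_of_level_card {q m : ℕ} (hq : 2 < q) (hm : Odd m) {a b : ℕ}
    (h1 : (a + (q - 1) * b : ℤ) = q ^ (2 * m)) (h2 : (a - b : ℤ) ^ 2 = q ^ (2 * m))
    (hdvd : q + 1 ∣ b) : b = q ^ (2 * m - 1) + q ^ (m - 1) ∧ a ≤ b := by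
  have hm0 : 0 < m := hm.pos
  obtain ⟨j, rfl⟩ : ∃ j, m = j + 1 := ⟨m - 1, by omega⟩
  have hq0 : (q : ℤ) ≠ 0 := by exact_mod_cast (by omega : q ≠ 0)
  rw [mul_comm 2, pow_mul, sq_eq_sq_iff_eq_or_eq_neg] at h2
  rcases h2 with h2 | h2
  · exfalso
    have hb : (q : ℤ) * b = q ^ (j + 1) * (q ^ (j + 1) - 1) := by
      have : (q : ℤ) ^ (2 * (j + 1)) = q ^ (j + 1) * q ^ (j + 1) := by ring
      linear_combination h1 + this - h2
    have hd : ((q : ℤ) + 1) ∣ q ^ (j + 1) * (q ^ (j + 1) - 1) := by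
      rw [← hb]
      exact (by exact_mod_cast hdvd : ((q : ℤ) + 1) ∣ b).mul_left _
    have hco : IsCoprime ((q : ℤ) + 1) (q ^ (j + 1)) :=
      IsCoprime.pow_right ⟨1, -1, by ring⟩
    have hd1 := hco.dvd_of_dvd_mul_left hd
    have hd2 : ((q : ℤ) + 1) ∣ q ^ (j + 1) + 1 := by
      simpa using hm.add_dvd_pow_add_pow (q : ℤ) 1
    have hd3 := dvd_sub hd2 hd1
    have := Int.le_of_dvd (by norm_num) (by ring_nf at hd3 ⊢; exact hd3 : ((q : ℤ) + 1) ∣ 2)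
    omega
  · have hpos : (0 : ℤ) < q ^ (j + 1) := by positivity
    refine ⟨?_, by omega⟩
    zify
    apply mul_left_cancel₀ hq0
    have e : 2 * (j + 1) - 1 = 2 * j + 1 := by omega
    rw [e, Nat.add_sub_cancel]
    linear_combination h1 - h2

section HermitianForm

variable {k F : Type*} [Field k] [Field F] [Algebra k F] [Finite F]

theorem finite_of_algebra_finite_field (k F : Type*) [Field k] [Field F] [Algebra k F]
    [Finite F] : Finite k :=
  Finite.of_injective _ (algebraMap k F).injective

theorem add_pow_natCard_pow (k : Type*) [Field k] [Algebra k F] (i : ℕ) (x y : F) :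
    (x + y) ^ Nat.card k ^ i = x ^ Nat.card k ^ i + y ^ Nat.card k ^ i := by
  have := finite_of_algebra_finite_field k F
  have := Fintype.ofFinite k
  have h := map_add (FiniteField.frobeniusAlgEquivOfAlgebraic k F ^ i) x y
  simpa only [AlgEquiv.coe_pow, FiniteField.coe_frobeniusAlgEquivOfAlgebraic_iterate,
    Fintype.card_eq_nat_card] using h

theorem trace_pow_natCard_pow (i : ℕ) (x : F) :
    Algebra.trace k F (x ^ Nat.card k ^ i) = Algebra.trace k F x := by
  have := finite_of_algebra_finite_field k F
  have := Fintype.ofFinite k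
  have h := Algebra.trace_eq_of_algEquiv (FiniteField.frobeniusAlgEquivOfAlgebraic k F ^ i) x
  simpa only [AlgEquiv.coe_pow, FiniteField.coe_frobeniusAlgEquivOfAlgebraic_iterate,
    Fintype.card_eq_nat_card] using h

theorem pow_natCard_pow_finrank (k : Type*) [Field k] [Algebra k F] (x : F) :
    x ^ Nat.card k ^ Module.finrank k F = x := by
  have := finite_of_algebra_finite_field k F
  have := Fintype.ofFinite F
  rw [← Module.natCard_eq_pow_finrank, Nat.card_eq_fintype_card, FiniteField.pow_card]

theorem algebraMap_pow_natCard_pow (c : k) (i : ℕ) :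
    (algebraMap k F c) ^ Nat.card k ^ i = algebraMap k F c := by
  have := finite_of_algebra_finite_field k F
  have := Fintype.ofFinite k
  rw [← map_pow, Nat.card_eq_fintype_card, FiniteField.pow_card_pow]

/-- The form `x ↦ Tr (x ^ (q ^ r + 1))` over the field with `q` elements. -/
noncomputable def traceHermitian (k : Type*) {F : Type*} [Field k] [Field F] [Algebra k F]
    (r : ℕ) (x : F) : k :=
  Algebra.trace k F (x ^ (Nat.card k ^ r + 1))

/-- The additive map `u ↦ u ^ q ^ r + u ^ q ^ (ℓ - r)` representing the polar form of
`traceHermitian k r` with respect to the trace form. -/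
noncomputable def traceHermitianAdjoint (k : Type*) {F : Type*} [Field k] [Field F] [Algebra k F]
    [Finite F] (r : ℕ) : F →+ F :=
  AddMonoidHom.mk' (fun u => u ^ Nat.card k ^ r + u ^ Nat.card k ^ (Module.finrank k F - r))
    fun x y => by
      simp only [add_pow_natCard_pow]
      abel

theorem traceHermitian_add {r : ℕ} (hr : r ≤ Module.finrank k F) (y u : F) :
    traceHermitian k r (y + u) = traceHermitian k r y +
      Algebra.trace k F (y * traceHermitianAdjoint k r u) + traceHermitian k r u := by
  have h : Algebra.trace k F (y ^ Nat.card k ^ r * u) =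
      Algebra.trace k F (y * u ^ Nat.card k ^ (Module.finrank k F - r)) := by
    rw [← trace_pow_natCard_pow (Module.finrank k F - r), mul_pow, ← pow_mul, ← pow_add,
      Nat.add_sub_cancel' hr, pow_natCard_pow_finrank]
  simp only [traceHermitian, pow_succ, add_pow_natCard_pow, mul_add, add_mul, map_add,
    traceHermitianAdjoint, AddMonoidHom.mk'_apply, h, mul_comm (u ^ Nat.card k ^ r) y]
  abel

theorem trace_mul_surjective {a : F} (ha : a ≠ 0) :
    Function.Surjective fun y : F => Algebra.trace k F (y * a) := by
  have := finite_of_algebra_finite_field k F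
  have h : Function.Surjective (Algebra.trace k F) := Algebra.trace_surjective k F
  intro c
  obtain ⟨x, rfl⟩ := h c
  exact ⟨x * a⁻¹, by simp [ha]⟩

theorem card_trace_eq (c : k) :
    Nat.card {y : F // Algebra.trace k F y = c} = Nat.card k ^ (Module.finrank k F - 1) := by
  have := finite_of_algebra_finite_field k F
  have h := (Algebra.trace k F).toAddMonoidHom.card_mul_card_fiber
    (Algebra.trace_surjective k F) c
  apply Nat.eq_of_mul_eq_mul_left (Nat.card_pos (α := k))
  rw [← pow_succ', Nat.sub_add_cancel Module.finrank_pos, ← Module.natCard_eq_pow_finrank]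
  exact h

theorem traceHermitianAdjoint_injective {r : ℕ} (hk : Odd (Nat.card k))
    (hl : Module.finrank k F % 4 = 2) (hl6 : 6 ≤ Module.finrank k F)
    (hr : r = Module.finrank k F / 2 + 2) :
    Function.Injective (traceHermitianAdjoint k r : F → F) := by
  rw [injective_iff_map_eq_zero]
  intro u hu
  set q := Nat.card k with hq
  set l := Module.finrank k F with hl'
  obtain ⟨j, hj⟩ : ∃ j, l = 4 * j + 2 := ⟨l / 4, by omega⟩
  have h4 : u ^ q ^ 4 = -u := by
    have h : u ^ q ^ r + u ^ q ^ (l - r) = 0 := hu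
    have e : r = 4 + (l - r) := by omega
    have e2 : q ^ r = q ^ 4 * q ^ (l - r) := by rw [← pow_add, ← e]
    rw [e2, pow_mul, ← add_pow_natCard_pow] at h
    exact eq_neg_of_add_eq_zero_left (pow_eq_zero_iff (pow_ne_zero _ hk.pos.ne') |>.1 h)
  have hiter (i : ℕ) : u ^ q ^ (4 * i) = (-1) ^ i * u := by
    induction i with
    | zero => simp
    | succ i ih =>
      rw [mul_add, mul_one, pow_add, pow_mul, ih, mul_pow, h4, ← pow_mul, mul_comm i, pow_mul,
        (hk.pow).neg_one_pow, pow_succ]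
      ring
  have h1 := hiter (2 * j + 1)
  have e : 4 * (2 * j + 1) = l + l := by omega
  rw [e, pow_add, pow_mul, pow_natCard_pow_finrank, pow_natCard_pow_finrank,
    (odd_two_mul_add_one j).neg_one_pow] at h1
  have h2 : (2 : F) ≠ 0 := by
    have := Fintype.ofFinite F
    refine Ring.two_ne_zero fun h => ?_
    rw [FiniteField.even_card_iff_char_two, ← Nat.card_eq_fintype_card,
      Module.natCard_eq_pow_finrank (K := k), ← Nat.even_iff] at h
    exact Nat.not_even_iff_odd.2 hk.pow h
  have : 2 * u = 0 := by linear_combination h1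
  exact (mul_eq_zero.1 this).resolve_left h2

theorem IsCyclic.exists_pow_eq_of_pow_eq_one {G : Type*} [CommGroup G] [IsCyclic G] [Finite G]
    {d : ℕ} (hd : d ∣ Nat.card G) {g : G} (hg : g ^ (Nat.card G / d) = 1) : ∃ h, h ^ d = g := by
  obtain ⟨z, hz⟩ := IsCyclic.exists_generator (α := G)
  obtain ⟨j, rfl⟩ := (mem_powers_iff_mem_zpowers.2 (hz g))
  obtain ⟨e, he⟩ := hd
  have hd0 : 0 < d := Nat.pos_of_ne_zero fun h => Nat.card_pos.ne' (by rw [he, h, zero_mul])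
  have he0 : 0 < e := Nat.pos_of_ne_zero fun h => Nat.card_pos.ne' (by rw [he, h, mul_zero])
  dsimp only at hg
  rw [he, Nat.mul_div_cancel_left _ hd0, ← pow_mul] at hg
  have h := orderOf_dvd_of_pow_eq_one hg
  rw [orderOf_eq_card_of_forall_mem_zpowers hz, he] at h
  obtain ⟨i, rfl⟩ := Nat.dvd_of_mul_dvd_mul_right he0 h
  exact ⟨z ^ i, by dsimp only; rw [← pow_mul, mul_comm]⟩

theorem succ_mul_pred_dvd_pow_sub_one {q l : ℕ} (hl : Even l) : (q + 1) * (q - 1) ∣ q ^ l - 1 := by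
  rw [← Nat.sq_sub_sq]
  obtain ⟨m, rfl⟩ := hl
  rw [← two_mul, pow_mul, one_pow]
  exact Nat.sub_one_dvd_pow_sub_one _ _

theorem card_traceHermitian_eq_const {r : ℕ} (hl : Even (Module.finrank k F)) (hr : Odd r)
    {c : k} (hc : c ≠ 0) :
    Nat.card {x : F // traceHermitian k r x = c} =
      Nat.card {x : F // traceHermitian k r x = 1} := by
  have := finite_of_algebra_finite_field k F
  have := Fintype.ofFinite k
  set q := Nat.card k with hq
  have hq1 : 1 < q := Finite.one_lt_card
  have hF : Nat.card F = q ^ Module.finrank k F := Module.natCard_eq_pow_finrank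
  let g : Fˣ := Units.map (algebraMap k F) (Units.mk0 c hc)
  have hg : g ^ (q - 1) = 1 := by
    rw [Units.ext_iff]
    change algebraMap k F c ^ (q - 1) = 1
    rw [← map_pow, hq, Nat.card_eq_fintype_card, FiniteField.pow_card_sub_one_eq_one c hc, map_one]
  obtain ⟨t, ht⟩ := succ_mul_pred_dvd_pow_sub_one (q := q) hl
  have hcard : Nat.card Fˣ = (q + 1) * ((q - 1) * t) := by
    rw [Nat.card_units, hF, ht, mul_assoc]
  obtain ⟨w, hw⟩ := IsCyclic.exists_pow_eq_of_pow_eq_one (d := q + 1) ⟨_, hcard⟩ (g := g) (by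
    rw [hcard, Nat.mul_div_cancel_left _ (Nat.succ_pos q), pow_mul, hg, one_pow])
  have hwq : w ^ q ^ 2 = w := by
    have : q ^ 2 = (q + 1) * (q - 1) + 1 := by
      obtain ⟨s, hs⟩ : ∃ s, q = s + 1 := ⟨q - 1, by omega⟩
      rw [hs, Nat.add_sub_cancel]; ring
    rw [this, pow_succ, pow_mul, hw, hg, one_mul]
  have hwr : w ^ (q ^ r + 1) = g := by
    obtain ⟨j, rfl⟩ := hr
    have : w ^ q ^ (2 * j) = w := by
      rw [pow_mul]
      induction j with
      | zero => simp
      | succ j ih => rw [pow_succ, pow_mul, ih, hwq]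
    rw [pow_succ w, pow_succ q, pow_mul, this, ← pow_succ, hw]
  have hwF : (w : F) ^ (q ^ r + 1) = algebraMap k F c := by
    rw [← Units.val_pow_eq_pow_val, hwr]; rfl
  symm
  refine Nat.card_congr ((Equiv.mulLeft₀ (w : F) w.ne_zero).subtypeEquiv fun x => ?_)
  change _ ↔ Algebra.trace k F ((w * x) ^ (q ^ r + 1)) = c
  rw [mul_pow, hwF, ← Algebra.smul_def, map_smul, smul_eq_mul]
  change traceHermitian k r x = 1 ↔ c * traceHermitian k r x = c
  exact ⟨fun h => by rw [h, mul_one], fun h => mul_left_cancel₀ hc (by rw [h, mul_one])⟩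

theorem MonoidHom.card_ker_dvd_card_preimage {G H : Type*} [Group G] [Group H]
    [Finite G] [Finite H]
    (f : G →* H) (P : H → Prop) : Nat.card f.ker ∣ Nat.card {x // P (f x)} := by
  have := Fintype.ofFinite H
  rw [← Nat.card_congr (Equiv.sigmaFiberEquiv fun x : {x // P (f x)} => f x.1), Nat.card_sigma]
  refine Finset.dvd_sum fun h _ => ?_
  rcases isEmpty_or_nonempty {x : {x // P (f x)} // f x.1 = h} with h0 | ⟨⟨⟨x, hx⟩, rfl⟩⟩
  · simp
  · let e : f.ker ≃ {y : {y // P (f y)} // f y.1 = f x} :=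
      { toFun := fun y => ⟨⟨x * y, by rwa [map_mul, y.2, mul_one]⟩, by
          rw [map_mul, y.2, mul_one]⟩
        invFun := fun y => ⟨x⁻¹ * y.1.1, by rw [MonoidHom.mem_ker, map_mul, y.2]; simp⟩
        left_inv := fun y => by simp
        right_inv := fun y => by simp }
    exact (Nat.card_congr e).dvd

theorem succ_dvd_card_traceHermitian {r : ℕ} (hl : Even (Module.finrank k F)) (hr : Odd r)
    {c : k} (hc : c ≠ 0) :
    Nat.card k + 1 ∣ Nat.card {x : F // traceHermitian k r x = c} := by
  have := finite_of_algebra_finite_field k F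
  set q := Nat.card k with hq
  have hF : Nat.card F = q ^ Module.finrank k F := Module.natCard_eq_pow_finrank
  obtain ⟨s, hs⟩ : q + 1 ∣ q ^ r + 1 := by simpa using hr.nat_add_dvd_pow_add_pow q 1
  let f : Fˣ →* Fˣ := powMonoidHom (q + 1)
  have hker : Nat.card f.ker = q + 1 := by
    rw [IsCyclic.card_powMonoidHom_ker, Nat.card_units, hF]
    exact Nat.gcd_eq_right ((Dvd.intro _ rfl).trans (succ_mul_pred_dvd_pow_sub_one hl))
  let e : {x : F // traceHermitian k r x = c} ≃ {x : Fˣ // traceHermitian k r (x : F) = c} :=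
    { toFun := fun x => ⟨Units.mk0 x.1 (by
        rintro h
        have := x.2
        rw [h, traceHermitian, zero_pow (Nat.succ_ne_zero _), map_zero] at this
        exact hc this.symm), x.2⟩
      invFun := fun x => ⟨x.1, x.2⟩
      left_inv := fun x => rfl
      right_inv := fun x => by ext; rfl }
  have h := f.card_ker_dvd_card_preimage fun z => Algebra.trace k F ((z : F) ^ s) = c
  rw [hker] at h
  convert h using 1
  refine Nat.card_congr (e.trans (Equiv.subtypeEquivRight fun x => ?_))
  rw [traceHermitian, ← hq, hs, pow_mul]
  rfl

theorem card_traceHermitian {r : ℕ} (hk : Odd (Nat.card k))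
    (hl : Module.finrank k F % 4 = 2) (hl6 : 6 ≤ Module.finrank k F)
    (hr : r = Module.finrank k F / 2 + 2) :
    (∀ c : k, c ≠ 0 → Nat.card {x : F // traceHermitian k r x = c} =
      Nat.card k ^ (Module.finrank k F - 1) + Nat.card k ^ (r - 3)) ∧
    Nat.card {x : F // traceHermitian k r x = 0} ≤
      Nat.card k ^ (Module.finrank k F - 1) + Nat.card k ^ (r - 3) := by
  have := finite_of_algebra_finite_field k F
  have hle : Even (Module.finrank k F) := by rw [Nat.even_iff]; omega
  have hro : Odd r := by rw [Nat.odd_iff]; omega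
  have hmo : Odd (Module.finrank k F / 2) := by rw [Nat.odd_iff]; omega
  have hq : 2 < Nat.card k := by
    have : 1 < Nat.card k := Finite.one_lt_card
    obtain ⟨i, hi⟩ := hk
    omega
  have hc (c : k) (hc : c ≠ 0) := card_traceHermitian_eq_const (F := F) hle hro hc
  have hinj := traceHermitianAdjoint_injective (k := k) (F := F) hk hl hl6 hr
  obtain ⟨h1, h2⟩ := card_level_sub_sq (V := F) (traceHermitian k r)
    (fun u => (Algebra.trace k F).toAddMonoidHom.comp
      (AddMonoidHom.mulRight (traceHermitianAdjoint k r u)))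
    (fun y u => traceHermitian_add (by omega) y u)
    (fun u hu => trace_mul_surjective ((map_ne_zero_iff _ hinj).2 hu)) hc
  have hF : Nat.card F = Nat.card k ^ (2 * (Module.finrank k F / 2)) := by
    rw [Module.natCard_eq_pow_finrank (K := k)]
    congr 1
    omega
  rw [hF] at h1 h2
  push_cast at h1 h2
  obtain ⟨h3, h4⟩ := sign_of_level_card hq hmo h1 h2
    (succ_dvd_card_traceHermitian hle hro one_ne_zero)
  have e1 : 2 * (Module.finrank k F / 2) - 1 = Module.finrank k F - 1 := by omega
  have e2 : Module.finrank k F / 2 - 1 = r - 3 := by omega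
  rw [e1, e2] at h3
  exact ⟨fun c h0 => (hc c h0).trans h3, h4.trans h3.le⟩

theorem card_graph_line_traceHermitian {r : ℕ} (hr : r ≤ Module.finrank k F) (u b : F) :
    Nat.card {x : F // Algebra.trace k F (traceHermitianAdjoint k r u * x + b) =
      traceHermitian k r x} =
    Nat.card {x : F // traceHermitian k r x =
      Algebra.trace k F (traceHermitianAdjoint k r u * u + b) - traceHermitian k r u} := by
  symm
  refine Nat.card_congr ((Equiv.addRight u).subtypeEquiv fun x => ?_)
  rw [Equiv.coe_addRight, traceHermitian_add hr, mul_add, add_assoc, map_add _ (_ * x),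
    mul_comm _ x]
  constructor <;> intro h <;> linear_combination -h

end HermitianForm

section ProjectivePlane

variable {F : Type*} [Field F]

theorem Projectivization.rep_mem_line_iff (α β γ : F) (v : Fin 3 → F) (hv : v ≠ 0) :
    α * (mk F v hv).rep 0 + β * (mk F v hv).rep 1 + γ * (mk F v hv).rep 2 = 0 ↔
      α * v 0 + β * v 1 + γ * v 2 = 0 := by
  obtain ⟨a, ha⟩ := exists_smul_eq_mk_rep F v hv
  rw [← ha]
  simp only [Pi.smul_apply, Units.smul_def, smul_eq_mul]
  have : α * (a * v 0) + β * (a * v 1) + γ * (a * v 2) =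
      a * (α * v 0 + β * v 1 + γ * v 2) := by ring
  rw [this, mul_eq_zero, or_iff_right a.ne_zero]

/-- The number of points on a line of a set of affine points together with `(0 : 1 : 0)`. -/
theorem Projectivization.card_inter_line [Finite F] (S : F → F → Prop)
    (K : Set (Projectivization F (Fin 3 → F)))
    (hK : K = {P | ∃ x y : F, S x y ∧
          P = Projectivization.mk F ![x, y, 1]
            (fun h => one_ne_zero (congrFun h 2))} ∪
        {Projectivization.mk F ![0, 1, 0]
            (fun h => one_ne_zero (congrFun h 1))}) (α β γ : F) [Decidable (β = 0)] :
    Nat.card ↥(K ∩ {P : Projectivization F (Fin 3 → F) |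
      α * P.rep 0 + β * P.rep 1 + γ * P.rep 2 = 0}) =
    Nat.card {z : F × F // S z.1 z.2 ∧ α * z.1 + β * z.2 + γ = 0} + if β = 0 then 1 else 0 := by
  let pt : F × F → Projectivization F (Fin 3 → F) := fun z =>
    mk F ![z.1, z.2, 1] (fun h => one_ne_zero (congrFun h 2))
  let o : Projectivization F (Fin 3 → F) :=
    mk F ![0, 1, 0] (fun h => one_ne_zero (congrFun h 1))
  have hpt : Function.Injective pt := by
    rintro ⟨x, y⟩ ⟨x', y'⟩ h
    obtain ⟨a, ha⟩ := (mk_eq_mk_iff' ..).1 h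
    have h0 := congrFun ha 0
    have h1 := congrFun ha 1
    have h2 := congrFun ha 2
    simp only [Pi.smul_apply, smul_eq_mul, Matrix.cons_val] at h0 h1 h2
    rw [mul_one] at h2
    simp [← h0, ← h1, h2]
  have ho (z) : pt z ≠ o := by
    intro h
    obtain ⟨a, ha⟩ := (mk_eq_mk_iff' ..).1 h
    simpa using congrFun ha 2
  have hset : K ∩ {P | α * P.rep 0 + β * P.rep 1 + γ * P.rep 2 = 0} =
      pt '' {z | S z.1 z.2 ∧ α * z.1 + β * z.2 + γ = 0} ∪ {P | P = o ∧ β = 0} := by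
    ext P
    simp only [hK, Set.mem_inter_iff, Set.mem_union, Set.mem_ofPred_eq, Set.mem_singleton_iff,
      Set.mem_image, Prod.exists]
    constructor
    · rintro ⟨⟨x, y, h, rfl⟩ | rfl, hl⟩
      · rw [rep_mem_line_iff] at hl
        exact Or.inl ⟨x, y, ⟨h, by simpa using hl⟩, rfl⟩
      · rw [rep_mem_line_iff] at hl
        exact Or.inr ⟨rfl, by simpa using hl⟩
    · rintro (⟨x, y, ⟨h, hl⟩, rfl⟩ | ⟨rfl, hl⟩)
      · exact ⟨Or.inl ⟨x, y, h, rfl⟩, (rep_mem_line_iff ..).2 (by simpa using hl)⟩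
      · exact ⟨Or.inr rfl, (rep_mem_line_iff ..).2 (by simpa using hl)⟩
  have hfin : {P | P = o ∧ β = 0}.Finite := (Set.finite_singleton o).subset fun P h => h.1
  rw [Nat.card_coe_set_eq, hset, Set.ncard_union_eq _ (Set.toFinite _) hfin,
    Set.ncard_image_of_injective _ hpt, ← Nat.card_coe_set_eq]
  · congr 1
    split_ifs with h <;> simp [h]
  · rw [Set.disjoint_left]
    rintro _ ⟨z, _, rfl⟩ h
    exact ho z h.1

theorem Projectivization.eq_mk_of_rep_ne_zero (P : Projectivization F (Fin 3 → F))
    (h : P.rep 2 ≠ 0) :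
    P = mk F ![P.rep 0 / P.rep 2, P.rep 1 / P.rep 2, 1]
      (fun h => one_ne_zero (congrFun h 2)) := by
  conv_lhs => rw [← P.mk_rep]
  refine (mk_eq_mk_iff' ..).2 ⟨P.rep 2, ?_⟩
  ext i
  fin_cases i <;> simp [mul_div_cancel₀, h]

theorem Projectivization.eq_mk_of_rep_eq_zero (P : Projectivization F (Fin 3 → F))
    (h0 : P.rep 0 = 0) (h2 : P.rep 2 = 0) :
    P = mk F ![0, 1, 0] (fun h => one_ne_zero (congrFun h 1)) := by
  conv_lhs => rw [← P.mk_rep]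
  refine (mk_eq_mk_iff' ..).2 ⟨P.rep 1, ?_⟩
  ext i
  fin_cases i <;> simp [h0, h2]

end ProjectivePlane

theorem exists_algebra_of_card_eq {p n ℓ : ℕ} (hp : p.Prime) (hn : 1 ≤ n)
    (F : Type) [Field F] [Fintype F] (hF : Fintype.card F = (p ^ n) ^ ℓ) :
    ∃ (k : Type) (_ : Field k) (_ : Algebra k F), Nat.card k = p ^ n ∧ Module.finrank k F = ℓ := by
  have : Fact p.Prime := ⟨hp⟩
  rw [← pow_mul] at hF
  have : CharP F p := charP_of_card_eq_prime_pow hF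
  let := ZMod.algebra F p
  have hfr : Module.finrank (ZMod p) F = n * ℓ := by
    have h := Module.natCard_eq_pow_finrank (K := ZMod p) (V := F)
    rw [Nat.card_eq_fintype_card, hF, Nat.card_zmod] at h
    exact (Nat.pow_right_injective hp.two_le h).symm
  obtain ⟨f⟩ := FiniteField.nonempty_algHom_of_finrank_dvd (F := ZMod p) (K := GaloisField p n)
    (L := F) (by rw [GaloisField.finrank p (by omega), hfr]; exact Dvd.intro _ rfl)
  let := f.toRingHom.toAlgebra
  have hk := GaloisField.card p n (by omega)
  refine ⟨GaloisField p n, inferInstance, inferInstance, hk, ?_⟩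
  have h := Module.natCard_eq_pow_finrank (K := GaloisField p n) (V := F)
  rw [Nat.card_eq_fintype_card, hF, hk, ← pow_mul] at h
  have := Nat.pow_right_injective hp.two_le h
  exact (Nat.eq_of_mul_eq_mul_left hn this).symm

/-- Let `p > 2` be prime, `q = p ^ n`, `ℓ ≥ 6` with `ℓ ≡ 2 (mod 4)` and
`r = ℓ/2 + 2`.  The pointset `K = {(x : y : 1) : T y = T (x^(q^r+1))} ∪ {(0 : 1 : 0)}` is a
complete `(N, d₁)`-arc in `PG(2, q^ℓ)` with `N = q^(2ℓ-1) + 1` and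
`d₁ = q^(ℓ-1) + q^(r-3)`. -/
theorem stmt_15 (p n : ℕ) (hp : p.Prime) (hp2 : 2 < p) (hn : 1 ≤ n)
    (q : ℕ) (hq : q = p ^ n)
    (ℓ r : ℕ) (hℓ : 6 ≤ ℓ) (hl4 : ℓ % 4 = 2) (hr : r = ℓ / 2 + 2)
    (F : Type) [Field F] [Fintype F] (hF : Fintype.card F = q ^ ℓ)
    (T : F → F) (hT : ∀ z : F, T z = ∑ i ∈ Finset.range ℓ, z ^ q ^ i)
    (K : Set (Projectivization F (Fin 3 → F)))
    (hK : K = {P | ∃ x y : F, T y = T (x ^ (q ^ r + 1)) ∧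
          P = Projectivization.mk F ![x, y, 1]
            (fun h => one_ne_zero (congrFun h 2))} ∪
        {Projectivization.mk F ![0, 1, 0]
            (fun h => one_ne_zero (congrFun h 1))}) :
    Nat.card ↥K = q ^ (2 * ℓ - 1) + 1 ∧
    (∀ α β γ : F, (α, β, γ) ≠ (0, 0, 0) →
      Nat.card ↥(K ∩ {P : Projectivization F (Fin 3 → F) |
          α * P.rep 0 + β * P.rep 1 + γ * P.rep 2 = 0})
        ≤ q ^ (ℓ - 1) + q ^ (r - 3)) ∧
    (∀ P : Projectivization F (Fin 3 → F), P ∉ K → ∃ α β γ : F,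
      (α, β, γ) ≠ (0, 0, 0) ∧ α * P.rep 0 + β * P.rep 1 + γ * P.rep 2 = 0 ∧
      Nat.card ↥(K ∩ {Q : Projectivization F (Fin 3 → F) |
          α * Q.rep 0 + β * Q.rep 1 + γ * Q.rep 2 = 0})
        = q ^ (ℓ - 1) + q ^ (r - 3)) := by
  subst hq
  obtain ⟨k, _, _, hk, hfr⟩ := exists_algebra_of_card_eq hp hn F hF
  have hTS (x y : F) : T y = T (x ^ ((p ^ n) ^ r + 1)) ↔
      Algebra.trace k F y = traceHermitian k r x := by
    rw [hT, hT, traceHermitian, ← (algebraMap k F).injective.eq_iff,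
      FiniteField.algebraMap_trace_eq_sum_pow, FiniteField.algebraMap_trace_eq_sum_pow, hfr, hk]
  simp only [hTS] at hK
  have hodd : Odd (Nat.card k) := hk ▸ (hp.odd_of_ne_two (by omega)).pow
  have hinj := traceHermitianAdjoint_injective (k := k) (F := F) (r := r) hodd (by rwa [hfr])
    (by rwa [hfr]) (by rwa [hfr])
  obtain ⟨hne, h0⟩ := card_traceHermitian (k := k) (F := F) (r := r) hodd (by rwa [hfr])
    (by rwa [hfr]) (by rwa [hfr])
  have htr := card_trace_eq (k := k) (F := F)
  rw [hfr, hk] at h0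
  simp only [hfr, hk] at hne htr
  have hgraph (a b : F) : Nat.card {z : F × F // Algebra.trace k F z.2 = traceHermitian k r z.1 ∧
      a * z.1 + -1 * z.2 + b = 0} =
      Nat.card {x : F // Algebra.trace k F (a * x + b) = traceHermitian k r x} :=
    Nat.card_congr
      { toFun := fun z => ⟨z.1.1, by
          rw [← z.2.1]; congr 1; linear_combination z.2.2⟩
        invFun := fun x => ⟨(x.1, a * x.1 + b), x.2, by ring⟩
        left_inv := fun z => Subtype.ext (Prod.ext rfl (by linear_combination z.2.2))
        right_inv := fun x => rfl }
  have hr' : r ≤ Module.finrank k F := by omega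
  classical
  have hcard := Projectivization.card_inter_line _ K hK
  have hline (u b : F) : Nat.card ↥(K ∩ {P : Projectivization F (Fin 3 → F) |
      traceHermitianAdjoint k r u * P.rep 0 + -1 * P.rep 1 + b * P.rep 2 = 0}) =
      Nat.card {x : F // traceHermitian k r x =
        Algebra.trace k F (traceHermitianAdjoint k r u * u + b) - traceHermitian k r u} := by
    rw [hcard, hgraph, card_graph_line_traceHermitian hr', if_neg (by simp), add_zero]
  have hsurj := Finite.surjective_of_injective hinj
  refine ⟨?_, ?_, ?_⟩
  · have h := hcard 0 0 0
    simp only [zero_mul, add_zero, Set.ofPred_true, Set.inter_univ, and_true, if_true] at h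
    rw [h]
    let e : {z : F × F // Algebra.trace k F z.2 = traceHermitian k r z.1} ≃
        Σ x : F, {y : F // Algebra.trace k F y = traceHermitian k r x} :=
      { toFun := fun z => ⟨z.1.1, z.1.2, z.2⟩
        invFun := fun z => ⟨(z.1, z.2.1), z.2.2⟩
        left_inv := fun z => rfl
        right_inv := fun z => rfl }
    rw [Nat.card_congr e, Nat.card_sigma, Finset.sum_congr rfl fun x _ => htr _]
    rw [Finset.sum_const, Finset.card_univ, hF, smul_eq_mul, ← pow_add]
    congr 2
    omega
  · intro α β γ h
    by_cases hβ : β = 0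
    · rw [hcard, if_pos hβ]
      have hpos : 0 < (p ^ n) ^ (r - 3) := pow_pos (pow_pos hp.pos _) _
      suffices Nat.card {z : F × F // Algebra.trace k F z.2 = traceHermitian k r z.1 ∧
          α * z.1 + β * z.2 + γ = 0} ≤ (p ^ n) ^ (ℓ - 1) by omega
      subst hβ
      by_cases hα : α = 0
      · subst hα
        have hγ : γ ≠ 0 := by rintro rfl; exact h rfl
        simp [hγ]
      · rw [← htr (traceHermitian k r (-γ / α))]
        have hx {x y : F} (h : α * x + 0 * y + γ = 0) : x = -γ / α := by
          rw [eq_div_iff hα]; linear_combination h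
        exact Nat.card_le_card_of_injective
          (fun z => ⟨z.1.2, by rw [z.2.1, hx z.2.2]⟩) fun z w hzw => Subtype.ext
            (Prod.ext ((hx z.2.2).trans (hx w.2.2).symm) (congrArg Subtype.val hzw))
    · obtain ⟨u, hu⟩ := hsurj (-α / β)
      have hl : {P : Projectivization F (Fin 3 → F) |
          α * P.rep 0 + β * P.rep 1 + γ * P.rep 2 = 0} = {P : Projectivization F (Fin 3 → F) |
          traceHermitianAdjoint k r u * P.rep 0 + -1 * P.rep 1 + -γ / β * P.rep 2 = 0} := by
        ext P
        simp only [Set.mem_ofPred_eq, hu]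
        field_simp
        constructor <;> intro h <;> linear_combination -h
      rw [hl, hline]
      rcases eq_or_ne (Algebra.trace k F (traceHermitianAdjoint k r u * u + -γ / β) -
        traceHermitian k r u) 0 with hc | hc
      · rwa [hc]
      · exact (hne _ hc).le
  · intro P hP
    have hneg (a b : F) : (a, (-1 : F), b) ≠ (0, 0, 0) := by simp
    by_cases h2 : P.rep 2 = 0
    · have h0 : P.rep 0 ≠ 0 := fun h0 => hP (by
        rw [hK, P.eq_mk_of_rep_eq_zero h0 h2]
        exact Or.inr rfl)
      obtain ⟨u, hu⟩ := hsurj (P.rep 1 / P.rep 0)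
      obtain ⟨b, hb⟩ := Algebra.trace_surjective k F (1 -
        Algebra.trace k F (traceHermitianAdjoint k r u * u) + traceHermitian k r u)
      refine ⟨traceHermitianAdjoint k r u, -1, b, hneg _ _, ?_, ?_⟩
      · rw [hu, h2]
        field_simp
        ring
      · rw [hline, map_add, hb]
        refine hne _ ?_
        ring_nf
        exact one_ne_zero
    · refine ⟨traceHermitianAdjoint k r (P.rep 0 / P.rep 2), -1, P.rep 1 / P.rep 2 -
        traceHermitianAdjoint k r (P.rep 0 / P.rep 2) * (P.rep 0 / P.rep 2), hneg _ _, ?_, ?_⟩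
      · field_simp
        ring
      · rw [hline, add_sub_cancel]
        refine hne _ (sub_ne_zero.2 fun h => hP ?_)
        rw [hK]
        exact Or.inl ⟨_, _, h, P.eq_mk_of_rep_ne_zero h2⟩
end

section
/- Let p be a prime, q = p^n, and let ℓ ≥ 4 with ℓ ≡ 0 (mod 4); set r = ℓ/2 + 1. Let K = {(x : y : 1) : x, y ∈ F_{q^ℓ}, T(y) = T(x^{q^r+1})} ∪ {(0:1:0)}, and let H = {B ∈ F_{q^ℓ} : the equation x^{q^{2r}} + x = B^{q^r} has a solution x ∈ F_{q^ℓ}}. Then for every subset H₁ ⊆ F_{q^ℓ} ∖ H with #H₁ = q^{ℓ−1} + q^{r−1} − 1, the pointset K₂ = K ∪ {(1 : B : 0) : B ∈ H₁} is a complete (N₂, d)-arc in PG(2, q^ℓ) with N₂ = q^{2ℓ−1} + q^{ℓ−1} + q^{r−1} and d = q^{ℓ−1} + q^{r−1}. -/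
/-- The twisted trace `∑ eⁱ x^(Qⁱ)`, `i < m`. -/
def twistedTrace {F : Type*} [Field F] (Q m : ℕ) (e x : F) : F :=
  ∑ i ∈ Finset.range m, e ^ i * x ^ Q ^ i

section TwistedTrace

theorem AddMonoidHom.ker_range_of_card_le {A : Type*} [AddCommGroup A] [Finite A] (f g : A →+ A)
    (hgf : ∀ x, g (f x) = 0) {a b : ℕ} (hf : Nat.card f.ker ≤ a) (hg : Nat.card g.ker ≤ b)
    (hab : Nat.card A = a * b) :
    Nat.card f.ker = a ∧ Nat.card g.ker = b ∧ f.range = g.ker := by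
  have h1 : Nat.card f.ker * Nat.card f.range = a * b := by
    rw [← hab, ← AddSubgroup.index_ker, AddSubgroup.card_mul_index]
  have hle : f.range ≤ g.ker := by
    rintro _ ⟨x, rfl⟩
    exact hgf x
  have h2 : Nat.card f.range ≤ Nat.card g.ker := AddSubgroup.card_le_of_le hle
  have hpos : 0 < a * b := hab ▸ Nat.card_pos
  have ha : 0 < a := Nat.pos_of_mul_pos_right hpos
  have hb : 0 < b := Nat.pos_of_mul_pos_left hpos
  have h3 : Nat.card f.ker = a := by
    by_contra hne
    have : Nat.card f.ker < a := lt_of_le_of_ne hf hne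
    nlinarith [Nat.mul_le_mul_left (Nat.card f.ker) (h2.trans hg)]
  have h4 : Nat.card f.range = b := by
    rw [h3] at h1
    exact Nat.eq_of_mul_eq_mul_left ha h1
  refine ⟨h3, le_antisymm hg (h4 ▸ h2), ?_⟩
  exact AddSubgroup.eq_of_le_of_card_ge hle (h4 ▸ hg)

variable {F : Type*} [Field F] {Q m : ℕ} {e : F}

theorem add_pow_pow_of_add_pow (hadd : ∀ x y : F, (x + y) ^ Q = x ^ Q + y ^ Q) (i : ℕ) (x y : F) :
    (x + y) ^ Q ^ i = x ^ Q ^ i + y ^ Q ^ i := by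
  induction i with
  | zero => simp
  | succ i ih => rw [pow_succ, pow_mul, ih, hadd, ← pow_mul, ← pow_mul]

theorem twistedTrace_add (hadd : ∀ x y : F, (x + y) ^ Q = x ^ Q + y ^ Q) (x y : F) :
    twistedTrace Q m e (x + y) = twistedTrace Q m e x + twistedTrace Q m e y := by
  simp only [twistedTrace, add_pow_pow_of_add_pow hadd, mul_add, Finset.sum_add_distrib]

theorem sum_pow_of_add_pow (hadd : ∀ x y : F, (x + y) ^ Q = x ^ Q + y ^ Q)
    {ι : Type*} (s : Finset ι) (f : ι → F) :
    (∑ i ∈ s, f i) ^ Q = ∑ i ∈ s, f i ^ Q :=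
  map_sum (AddMonoidHom.mk' (fun x : F => x ^ Q) hadd) f s

theorem pow_pow_eq_self {e : F} (he : e ^ Q = e) (i : ℕ) : e ^ Q ^ i = e := by
  induction i with
  | zero => simp
  | succ i ih => rw [pow_succ, pow_mul, ih, he]

theorem twistedTrace_telescope (hm : e ^ m = 1) (hfix : ∀ x : F, x ^ Q ^ m = x) (x : F) :
    ∑ i ∈ Finset.range m, e ^ (i + 1) * x ^ Q ^ (i + 1) = twistedTrace Q m e x := by
  have h := Finset.sum_range_succ (fun i => e ^ i * x ^ Q ^ i) m
  rw [Finset.sum_range_succ', hm, hfix] at h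
  simpa [twistedTrace] using h

theorem mul_twistedTrace_pow (hadd : ∀ x y : F, (x + y) ^ Q = x ^ Q + y ^ Q)
    (he : e ^ Q = e) (hm : e ^ m = 1) (hfix : ∀ x : F, x ^ Q ^ m = x) (x : F) :
    e * twistedTrace Q m e x ^ Q = twistedTrace Q m e x := by
  conv_rhs => rw [← twistedTrace_telescope hm hfix]
  rw [twistedTrace, sum_pow_of_add_pow hadd, Finset.mul_sum]
  refine Finset.sum_congr rfl fun i _ => ?_
  rw [mul_pow, ← pow_mul, ← pow_mul, mul_comm i, pow_mul, he, ← pow_succ, pow_succ e]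
  ring

theorem twistedTrace_mul_pow (he : e ^ Q = e) (hm : e ^ m = 1) (hfix : ∀ x : F, x ^ Q ^ m = x)
    (x : F) : twistedTrace Q m e (e * x ^ Q) = twistedTrace Q m e x := by
  rw [← twistedTrace_telescope hm hfix x, twistedTrace]
  refine Finset.sum_congr rfl fun i _ => ?_
  rw [mul_pow, pow_pow_eq_self he, ← pow_mul, ← pow_succ', pow_succ e]
  ring

open Polynomial in
theorem card_eval_eq_zero_le [Finite F] {P : F[X]} {d : ℕ} (hd : P.natDegree ≤ d)
    (h1 : P.coeff 1 ≠ 0) : Nat.card {x : F // P.eval x = 0} ≤ d := by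
  classical
  have := Fintype.ofFinite F
  have hP : P ≠ 0 := by
    rintro rfl
    simp at h1
  rw [Nat.card_eq_fintype_card, Fintype.card_subtype]
  refine le_trans (le_trans (Finset.card_le_card (t := P.roots.toFinset) ?_)
    (Multiset.toFinset_card_le _)) ((P.card_roots').trans hd)
  intro x hx
  simpa [hP] using hx

open Polynomial in
theorem card_twistedTrace_eq_zero_le [Finite F] (hQ : 2 ≤ Q) (hm : 1 ≤ m) :
    Nat.card {x : F // twistedTrace Q m e x = 0} ≤ Q ^ (m - 1) := by
  have := card_eval_eq_zero_le (F := F)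
    (P := ∑ i ∈ Finset.range m, C (e ^ i) * X ^ Q ^ i) (d := Q ^ (m - 1)) ?_ ?_
  · simpa [twistedTrace, eval_finsetSum] using this
  · refine natDegree_sum_le_of_forall_le _ _ fun i hi => ?_
    refine (natDegree_C_mul_X_pow_le _ _).trans (Nat.pow_le_pow_right (by omega) ?_)
    have := Finset.mem_range.1 hi
    omega
  · rw [finsetSum_coeff, Finset.sum_eq_single 0]
    · simp
    · intro i _ hi
      have : 1 ≠ Q ^ i := (Nat.one_lt_pow hi hQ).ne
      simp only [coeff_C_mul_X_pow, if_neg this]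
    · intro h
      exact absurd (Finset.mem_range.2 hm) h

open Polynomial in
theorem card_sub_mul_pow_eq_zero_le [Finite F] (hQ : 2 ≤ Q) :
    Nat.card {x : F // x - e * x ^ Q = 0} ≤ Q := by
  have := card_eval_eq_zero_le (F := F) (P := X - C e * X ^ Q) (d := Q) ?_ ?_
  · simpa using this
  · refine (natDegree_sub_le _ _).trans (max_le ?_ (natDegree_C_mul_X_pow_le _ _))
    rw [natDegree_X]
    omega
  · have : 1 ≠ Q := by omega
    simp [coeff_X_pow, this]

/-- Additive Hilbert 90 for twisted traces, with the exact sizes of the kernels. -/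
theorem twistedTrace_exact [Finite F] (hQ : 2 ≤ Q) (hm1 : 1 ≤ m)
    (hadd : ∀ x y : F, (x + y) ^ Q = x ^ Q + y ^ Q)
    (he : e ^ Q = e) (hm : e ^ m = 1) (hcard : Nat.card F = Q ^ m) :
    Nat.card {x : F // twistedTrace Q m e x = 0} = Q ^ (m - 1) ∧
    Nat.card {x : F // x = e * x ^ Q} = Q ∧
    (∀ y : F, y = e * y ^ Q ↔ ∃ x, twistedTrace Q m e x = y) ∧
    (∀ y : F, twistedTrace Q m e y = 0 ↔ ∃ x, x - e * x ^ Q = y) := by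
  have hfix : ∀ x : F, x ^ Q ^ m = x := fun x => by
    have := Fintype.ofFinite F
    rw [← hcard, Nat.card_eq_fintype_card, FiniteField.pow_card]
  let f : F →+ F := AddMonoidHom.mk' (twistedTrace Q m e) (twistedTrace_add hadd)
  let g : F →+ F := AddMonoidHom.mk' (fun x => x - e * x ^ Q) fun x y => by
    rw [hadd]
    ring
  have hf : Nat.card f.ker ≤ Q ^ (m - 1) := card_twistedTrace_eq_zero_le hQ hm1
  have hg : Nat.card g.ker ≤ Q := card_sub_mul_pow_eq_zero_le hQ
  have hc : Nat.card F = Q ^ (m - 1) * Q := by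
    rw [hcard, ← pow_succ, Nat.sub_add_cancel hm1]
  obtain ⟨h1, h2, h3⟩ := f.ker_range_of_card_le g
    (fun x => sub_eq_zero.2 (mul_twistedTrace_pow hadd he hm hfix x).symm) hf hg hc
  obtain ⟨-, -, h4⟩ := g.ker_range_of_card_le f
    (fun x => by
      have : f (e * x ^ Q) = f x := twistedTrace_mul_pow he hm hfix x
      change f (x - e * x ^ Q) = 0
      rw [map_sub, this, sub_self]) hg hf (hc.trans (mul_comm _ _))
  refine ⟨h1, ?_, fun y => ?_, fun y => ?_⟩
  · refine Eq.trans (Nat.card_congr (Equiv.subtypeEquivRight fun x => ?_)) h2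
    exact sub_eq_zero.symm
  · rw [← sub_eq_zero]
    exact (SetLike.ext_iff.1 h3 y).symm
  · exact (SetLike.ext_iff.1 h4 y).symm

end TwistedTrace

/-- `F` is a finite field of cardinality `q ^ (4 * s)` on which `x ↦ x ^ q` is additive. -/
structure IsFourfoldExtension (q s : ℕ) (F : Type*) [Field F] [Fintype F] : Prop where
  two_le : 2 ≤ q
  pos : 1 ≤ s
  card : Fintype.card F = q ^ (4 * s)
  add_pow : ∀ x y : F, (x + y) ^ q = x ^ q + y ^ q

/-- The trace from the field with `q ^ (4 * s)` elements to the one with `q` elements. -/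
def fieldTrace {F : Type*} [Field F] (q s : ℕ) (x : F) : F := twistedTrace q (4 * s) 1 x

/-- The quadratic form `x ↦ Tr (x ^ (q ^ (2 * s + 1) + 1))`. -/
def hermForm {F : Type*} [Field F] (q s : ℕ) (x : F) : F :=
  fieldTrace q s (x ^ q ^ (2 * s + 1) * x)

namespace IsFourfoldExtension

variable {q s : ℕ} {F : Type*} [Field F] [Fintype F] (h : IsFourfoldExtension q s F)
include h

theorem pow_card (x : F) : x ^ q ^ (4 * s) = x := by
  rw [← h.card, FiniteField.pow_card]

theorem add_pow_pow (i : ℕ) (x y : F) : (x + y) ^ q ^ i = x ^ q ^ i + y ^ q ^ i :=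
  add_pow_pow_of_add_pow h.add_pow i x y

theorem zero_pow_pow (i : ℕ) : (0 : F) ^ q ^ i = 0 :=
  zero_pow (pow_ne_zero _ (by have := h.two_le; omega))

theorem neg_pow_pow (i : ℕ) (x : F) : (-x) ^ q ^ i = -x ^ q ^ i := by
  rw [eq_neg_iff_add_eq_zero, ← h.add_pow_pow, neg_add_cancel, h.zero_pow_pow]

theorem trace_add (x y : F) : fieldTrace q s (x + y) = fieldTrace q s x + fieldTrace q s y :=
  twistedTrace_add h.add_pow x y

theorem trace_zero : fieldTrace q s (0 : F) = 0 :=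
  map_zero (AddMonoidHom.mk' _ h.trace_add)

theorem trace_sum {ι : Type*} (t : Finset ι) (f : ι → F) :
    fieldTrace q s (∑ i ∈ t, f i) = ∑ i ∈ t, fieldTrace q s (f i) :=
  map_sum (AddMonoidHom.mk' _ h.trace_add) f t

theorem trace_pow (x : F) : fieldTrace q s (x ^ q) = fieldTrace q s x := by
  simpa [fieldTrace] using
    twistedTrace_mul_pow (Q := q) (m := 4 * s) (e := (1 : F)) (one_pow _) (one_pow _) h.pow_card x

theorem trace_pow_pow (i : ℕ) (x : F) : fieldTrace q s (x ^ q ^ i) = fieldTrace q s x := by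
  induction i with
  | zero => simp
  | succ i ih => rw [pow_succ, pow_mul, h.trace_pow, ih]

theorem trace_pow_eq (x : F) : fieldTrace q s x ^ q = fieldTrace q s x := by
  simpa [fieldTrace] using
    mul_twistedTrace_pow (Q := q) (m := 4 * s) (e := (1 : F)) h.add_pow (one_pow _) (one_pow _)
      h.pow_card x

omit h [Fintype F] in
theorem trace_mul_of_pow_eq {c : F} (hc : c ^ q = c) (x : F) :
    fieldTrace q s (c * x) = c * fieldTrace q s x := by
  simp only [fieldTrace, twistedTrace, Finset.mul_sum]
  refine Finset.sum_congr rfl fun i _ => ?_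
  rw [mul_pow, pow_pow_eq_self hc]
  ring

theorem exact_trace :
    Nat.card {x : F // fieldTrace q s x = 0} = q ^ (4 * s - 1) ∧
    Nat.card {x : F // x = x ^ q} = q ∧
    (∀ y : F, y = y ^ q ↔ ∃ x, fieldTrace q s x = y) := by
  obtain ⟨h1, h2, h3, -⟩ := twistedTrace_exact (F := F) (Q := q) (m := 4 * s) (e := 1) h.two_le
    (by have := h.pos; omega) h.add_pow (one_pow _) (one_pow _)
    (by rw [Nat.card_eq_fintype_card, h.card])
  simp only [one_mul] at h2 h3
  exact ⟨h1, h2, h3⟩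

theorem exists_trace_eq {c : F} (hc : c ^ q = c) : ∃ x, fieldTrace q s x = c :=
  (h.exact_trace.2.2 c).1 hc.symm

theorem eq_zero_of_trace_mul {a : F} (ha : ∀ z, fieldTrace q s (a * z) = 0) : a = 0 := by
  by_contra hne
  obtain ⟨x, hx⟩ := h.exists_trace_eq (one_pow q : (1 : F) ^ q = 1)
  have := ha (a⁻¹ * x)
  rw [mul_inv_cancel_left₀ hne, hx] at this
  exact one_ne_zero this

theorem neg_one_pow : (-1 : F) ^ q = -1 := by
  simpa using h.neg_pow_pow 1 1

theorem neg_one_pow_sq : (-1 : F) ^ q ^ 2 = -1 := by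
  simpa using h.neg_pow_pow 2 1

theorem add_pow_sq (x y : F) : (x + y) ^ q ^ 2 = x ^ q ^ 2 + y ^ q ^ 2 := h.add_pow_pow 2 x y

omit h [Fintype F] in
theorem neg_one_pow_two_mul : (-1 : F) ^ (2 * s) = 1 := by
  rw [pow_mul]
  simp

theorem pow_card' (x : F) : x ^ (q ^ 2) ^ (2 * s) = x := by
  rw [← pow_mul, show 2 * (2 * s) = 4 * s by ring, h.pow_card]

theorem exact_alternating :
    Nat.card {x : F // x ^ q ^ 2 + x = 0} = q ^ 2 ∧
    (∀ x : F, twistedTrace (q ^ 2) (2 * s) (-1) x ^ q ^ 2 +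
      twistedTrace (q ^ 2) (2 * s) (-1) x = 0) ∧
    (∀ y : F, twistedTrace (q ^ 2) (2 * s) (-1) y = 0 → ∃ x, x ^ q ^ 2 + x = y) := by
  obtain ⟨-, h2, h3, h4⟩ := twistedTrace_exact (F := F) (Q := q ^ 2) (m := 2 * s) (e := -1)
    (by nlinarith [h.two_le]) (by have := h.pos; omega) h.add_pow_sq h.neg_one_pow_sq
    neg_one_pow_two_mul
    (by rw [Nat.card_eq_fintype_card, h.card, ← pow_mul]; ring_nf)
  have key : ∀ x : F, x = -1 * x ^ q ^ 2 ↔ x ^ q ^ 2 + x = 0 := fun x => by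
    rw [neg_one_mul, eq_neg_iff_add_eq_zero, add_comm]
  refine ⟨?_, fun x => ?_, fun y hy => ?_⟩
  · exact (Nat.card_congr (Equiv.subtypeEquivRight fun x => (key x).symm)).trans h2
  · exact (key _).1 ((h3 _).2 ⟨x, rfl⟩)
  · obtain ⟨x, hx⟩ := (h4 y).1 hy
    exact ⟨x, by rw [← hx]; ring⟩

theorem trace_alternating_mul (z y : F) :
    fieldTrace q s (twistedTrace (q ^ 2) (2 * s) (-1) z * y) =
      fieldTrace q s (z * twistedTrace (q ^ 2) (2 * s) (-1) y) := by
  rw [← twistedTrace_telescope neg_one_pow_two_mul h.pow_card' y, twistedTrace, Finset.sum_mul,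
    Finset.mul_sum, h.trace_sum, h.trace_sum, ← Finset.sum_range_reflect]
  refine Finset.sum_congr rfl fun i hi => ?_
  have hi' := Finset.mem_range.1 hi
  obtain ⟨j, hj⟩ : ∃ j, 2 * s = i + 1 + j := ⟨2 * s - (i + 1), by omega⟩
  have h1 : 2 * s - 1 - i = j := by omega
  have hs : (-1 : F) ^ j = (-1) ^ (i + 1) := by
    have := neg_one_pow_two_mul (F := F) (s := s)
    rw [hj, pow_add] at this
    rcases neg_one_pow_eq_or F (i + 1) with h' | h' <;> rw [h'] at this ⊢
    · simpa using this
    · linear_combination -this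
  have hc : ∀ (k : ℕ) (x : F), ((-1 : F) ^ k * x) ^ q = (-1 : F) ^ k * x ^ q := fun k x => by
    rw [mul_pow, ← pow_mul, mul_comm k, pow_mul, h.neg_one_pow]
  have hf : ((-1 : F) ^ (i + 1)) ^ q = (-1) ^ (i + 1) := by
    simpa using hc (i + 1) 1
  rw [h1, hs, mul_assoc, mul_left_comm z, trace_mul_of_pow_eq hf, trace_mul_of_pow_eq hf,
    ← h.trace_pow_pow (2 * j) (z * _), pow_mul, mul_pow, ← pow_mul y, ← pow_add, ← hj, h.pow_card']

omit h [Fintype F] in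
theorem pow_pow_pow (x : F) (i j : ℕ) : (x ^ q ^ i) ^ q ^ j = x ^ q ^ (i + j) := by
  rw [← pow_mul, ← pow_add]

theorem radical_pow {w : F} (hw : w ^ q ^ 2 + w = 0) (i : ℕ) :
    (w ^ q ^ i) ^ q ^ 2 + w ^ q ^ i = 0 := by
  rw [pow_pow_pow, add_comm i, ← pow_pow_pow, ← h.add_pow_pow, hw, h.zero_pow_pow]

/-- The orthogonal complement of the radical is the image of `u ↦ u ^ q ^ 2 + u`, up to a
Frobenius twist. -/
theorem exists_of_trace_mul_radical {B : F}
    (hB : ∀ w : F, w ^ q ^ 2 + w = 0 → fieldTrace q s (B * w) = 0) :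
    ∃ u : F, u ^ q ^ 2 + u = B ^ q ^ (2 * s + 1) := by
  obtain ⟨-, h2, h3⟩ := h.exact_alternating
  refine h3 _ (h.eq_zero_of_trace_mul fun z => ?_)
  rw [h.trace_alternating_mul]
  have := hB _ (h.radical_pow (h2 z) (2 * s - 1))
  rwa [← h.trace_pow_pow (2 * s + 1), mul_pow, pow_pow_pow,
    show 2 * s - 1 + (2 * s + 1) = 4 * s by have := h.pos; omega, h.pow_card] at this

theorem trace_polar (x y : F) :
    fieldTrace q s (x ^ q ^ (2 * s + 1) * y) + fieldTrace q s (y ^ q ^ (2 * s + 1) * x) =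
      fieldTrace q s (y ^ q ^ (2 * s + 1) * (x ^ q ^ 2 + x)) := by
  rw [← h.trace_pow_pow (2 * s + 1) (_ * y), mul_pow, pow_pow_pow,
    show 2 * s + 1 + (2 * s + 1) = 4 * s + 2 by ring, ← pow_pow_pow, h.pow_card, ← h.trace_add]
  ring_nf

theorem hermForm_add (x y : F) :
    hermForm q s (x + y) = hermForm q s x + hermForm q s y +
      fieldTrace q s (y ^ q ^ (2 * s + 1) * (x ^ q ^ 2 + x)) := by
  rw [← h.trace_polar]
  simp only [hermForm, ← h.trace_add, h.add_pow_pow]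
  ring_nf

theorem hermForm_pow_eq (x : F) : hermForm q s x ^ q = hermForm q s x := h.trace_pow_eq _

theorem hermForm_radical {w : F} (hw : w ^ q ^ 2 + w = 0) : hermForm q s w = 0 := by
  have hw' : w ^ q ^ 2 = -w := eq_neg_of_add_eq_zero_left hw
  have hj : ∀ j, w ^ q ^ (2 * j) = (-1) ^ j * w := fun j => by
    induction j with
    | zero => simp
    | succ j ih =>
      rw [show 2 * (j + 1) = 2 + 2 * j by ring, ← pow_pow_pow, hw', h.neg_pow_pow, ih]
      ring
  have hN : ∀ i, (w ^ q * w) ^ q ^ i = (-1) ^ i * (w ^ q * w) := fun i => by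
    induction i with
    | zero => simp
    | succ i ih =>
      have h1 : (w ^ q * w) ^ q = -(w ^ q * w) := by
        rw [mul_pow, ← pow_mul, ← sq, hw']
        ring
      rw [pow_succ', pow_mul, h1, h.neg_pow_pow, ih]
      ring
  have hT : fieldTrace q s (w ^ q * w) = 0 := by
    simp only [fieldTrace, twistedTrace, one_pow, one_mul, hN, ← Finset.sum_mul]
    rw [neg_one_geom_sum, if_pos ⟨2 * s, by ring⟩, zero_mul]
  have hs : ((-1 : F) ^ s) ^ q = (-1) ^ s := by
    rw [← pow_mul, mul_comm, pow_mul, h.neg_one_pow]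
  rw [hermForm, ← pow_pow_pow, hj, pow_one, mul_pow, hs, mul_assoc, trace_mul_of_pow_eq hs, hT,
    mul_zero]

omit h [Fintype F] in
theorem hermForm_mul {a : F} (ha : a ^ q ^ 2 = a) (x : F) :
    hermForm q s (a * x) = a ^ (q + 1) * hermForm q s x := by
  have h1 : a ^ q ^ (2 * s + 1) = a ^ q := by
    rw [pow_succ, pow_mul, pow_mul q, pow_pow_eq_self ha]
  have h2 : (a ^ (q + 1)) ^ q = a ^ (q + 1) := by
    rw [← pow_mul, add_mul, one_mul, pow_add, ← sq, ha, pow_succ, mul_comm]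
  rw [hermForm, hermForm, mul_pow, h1, ← trace_mul_of_pow_eq h2]
  ring_nf

variable [DecidableEq F]

theorem card_fixed : (Finset.univ.filter fun c : F => c ^ q = c).card = q := by
  conv_rhs => rw [← h.exact_trace.2.1]
  rw [Nat.card_eq_fintype_card, Fintype.card_subtype]
  simp only [eq_comm]

theorem card_radical : (Finset.univ.filter fun w : F => w ^ q ^ 2 + w = 0).card = q ^ 2 := by
  refine Eq.trans ?_ (h.exact_alternating (F := F)).1
  rw [Nat.card_eq_fintype_card, Fintype.card_subtype]

theorem card_trace_eq {c : F} (hc : c ^ q = c) :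
    (Finset.univ.filter fun y : F => fieldTrace q s y = c).card = q ^ (4 * s - 1) := by
  rw [← h.exact_trace.1, Nat.card_eq_fintype_card, Fintype.card_subtype]
  obtain ⟨x, hx⟩ := h.exists_trace_eq hc
  refine (Finset.card_equiv (Equiv.addRight x) fun y => ?_).symm
  simp [h.trace_add, hx]

theorem card_trace_mul_eq {a c : F} (ha : a ≠ 0) (hc : c ^ q = c) :
    (Finset.univ.filter fun y : F => fieldTrace q s (y * a) = c).card = q ^ (4 * s - 1) := by
  rw [← h.card_trace_eq hc]
  refine Finset.card_equiv (Equiv.mulRight₀ a ha) fun y => ?_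
  simp

omit [DecidableEq F] in
theorem pow_succ_pred : q ^ (4 * s - 1) * q = q ^ (4 * s) := by
  rw [← pow_succ, Nat.sub_add_cancel (by have := h.pos; omega)]

theorem sum_fibers (f : F → F) (hf : ∀ x, f x ^ q = f x) :
    ∑ c ∈ Finset.univ.filter (fun c : F => c ^ q = c),
      (Finset.univ.filter fun x : F => f x = c).card = q ^ (4 * s) := by
  rw [← h.card, ← Finset.card_univ]
  exact (Finset.card_eq_sum_card_fiberwise fun x _ => by simp [hf]).symm

/-- On a line whose slope is not orthogonal to the radical, the form is equidistributed. -/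
theorem card_line_of_trace_ne_zero {B w : F} (hw : w ^ q ^ 2 + w = 0)
    (hB : fieldTrace q s (B * w) ≠ 0) (C : F) :
    (Finset.univ.filter fun x : F => fieldTrace q s (B * x + C) = hermForm q s x).card =
      q ^ (4 * s - 1) := by
  set t := fieldTrace q s (B * w) with ht
  have htq : t ^ q = t := h.trace_pow_eq _
  let f : F → F := fun x => hermForm q s x - fieldTrace q s (B * x + C)
  have hneg : ∀ x : F, (-x) ^ q = -x ^ q := fun x => by simpa using h.neg_pow_pow 1 x
  have hf : ∀ x, f x ^ q = f x := fun x => by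
    simp only [f, sub_eq_add_neg, h.add_pow, hneg, h.trace_pow_eq, h.hermForm_pow_eq]
  have hshift : ∀ a : F, a ^ q = a → ∀ x, f (x + a * w) = f x - a * t := fun a ha x => by
    have ha' : a ^ q ^ 2 = a := pow_pow_eq_self ha 2
    have hr : (a * w) ^ q ^ 2 + a * w = 0 := by
      rw [mul_pow, ha', ← mul_add, hw, mul_zero]
    have h1 : hermForm q s (x + a * w) = hermForm q s x := by
      rw [add_comm x, h.hermForm_add, hr, mul_zero, h.trace_zero, h.hermForm_radical hr]
      ring
    have h2 : fieldTrace q s (B * (x + a * w) + C) = fieldTrace q s (B * x + C) + a * t := by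
      rw [ht, ← trace_mul_of_pow_eq ha, ← h.trace_add]
      ring_nf
    simp only [f, h1, h2]
    ring
  have hconst : ∀ c : F, c ^ q = c → (Finset.univ.filter fun x : F => f x = c).card =
      (Finset.univ.filter fun x : F => f x = 0).card := fun c hc => by
    have ha : (c / t) ^ q = c / t := by rw [div_pow, hc, htq]
    refine Finset.card_equiv (Equiv.addRight (c / t * w)) fun x => ?_
    simp [hshift _ ha, div_mul_cancel₀ _ hB, sub_eq_zero]
  have hsum := h.sum_fibers f hf
  rw [Finset.sum_congr rfl fun c hc => hconst c (Finset.mem_filter.1 hc).2, Finset.sum_const,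
    h.card_fixed, smul_eq_mul, ← h.pow_succ_pred, mul_comm] at hsum
  rw [← Nat.eq_of_mul_eq_mul_right (by have := h.two_le; omega) hsum]
  congr 1
  ext x
  simp [f, sub_eq_zero, eq_comm]

omit [DecidableEq F] in
theorem trace_mul_eq_polar {B u : F} (hu : u ^ q ^ 2 + u = B ^ q ^ (2 * s + 1)) (x : F) :
    fieldTrace q s (B * x) = fieldTrace q s (x ^ q ^ (2 * s + 1) * (u ^ q ^ 2 + u)) := by
  rw [← h.trace_pow_pow (2 * s + 1), mul_pow, hu, mul_comm]

omit [DecidableEq F] in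
theorem trace_mul_self {B u : F} (hu : u ^ q ^ 2 + u = B ^ q ^ (2 * s + 1)) :
    fieldTrace q s (B * u) = hermForm q s u + hermForm q s u := by
  rw [h.trace_mul_eq_polar hu, ← h.trace_polar, hermForm]

theorem card_line_of_exists {B u : F} (hu : u ^ q ^ 2 + u = B ^ q ^ (2 * s + 1)) (C : F) :
    (Finset.univ.filter fun x : F => fieldTrace q s (B * x + C) = hermForm q s x).card =
      (Finset.univ.filter fun x : F => hermForm q s x = hermForm q s u + fieldTrace q s C).card := by
  refine (Finset.card_equiv (Equiv.addLeft u) fun x => ?_).symm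
  simp only [Finset.mem_filter, Finset.mem_univ, true_and, Equiv.coe_addLeft]
  rw [h.hermForm_add, mul_add, h.trace_add, h.trace_add, h.trace_mul_self hu,
    h.trace_mul_eq_polar hu x]
  constructor <;> intro h' <;> linear_combination -h'

omit [DecidableEq F] in
theorem exists_generator : ∃ g : F, IsPrimitiveRoot g (q ^ (4 * s) - 1) ∧
    ∀ c : F, c ≠ 0 → ∃ k : ℕ, g ^ k = c := by
  classical
  obtain ⟨g, hg⟩ := IsCyclic.exists_monoid_generator (α := Fˣ)
  have hord : orderOf g = q ^ (4 * s) - 1 := by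
    rw [orderOf_eq_card_of_forall_mem_powers hg, Nat.card_eq_fintype_card, Fintype.card_units,
      h.card]
  refine ⟨g, ?_, fun c hc => ?_⟩
  · rw [← hord]
    exact IsPrimitiveRoot.coe_units_iff.2 (IsPrimitiveRoot.orderOf g)
  · obtain ⟨k, hk⟩ := hg (Units.mk0 c hc)
    exact ⟨k, by simpa using congrArg Units.val hk⟩

omit [Field F] [Fintype F] [DecidableEq F] h in
theorem exists_pow_sub_one_eq :
    ∃ k, q ^ (4 * s) - 1 = (q + 1) * (q - 1) * k := by
  have := Nat.sub_dvd_pow_sub_pow (q ^ 2) 1 (2 * s)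
  rw [one_pow, ← pow_mul, show 2 * (2 * s) = 4 * s by ring] at this
  have h2 : q ^ 2 - 1 = (q + 1) * (q - 1) := by
    simpa using Nat.sq_sub_sq q 1
  rwa [h2] at this

omit [DecidableEq F] in
theorem pow_sub_one_pos : 0 < q ^ (4 * s) - 1 := by
  have := Nat.one_lt_pow (n := 4 * s) (by have := h.pos; omega) h.two_le
  omega

omit [DecidableEq F] in
theorem exists_norm_eq {c : F} (hc0 : c ≠ 0) (hc : c ^ q = c) :
    ∃ a : F, a ^ q ^ 2 = a ∧ a ^ (q + 1) = c := by
  obtain ⟨g, hg, hgen⟩ := h.exists_generator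
  obtain ⟨k, rfl⟩ := hgen c hc0
  obtain ⟨j, hj⟩ := exists_pow_sub_one_eq (q := q) (s := s)
  have hq : q - 1 + 1 = q := by have := h.two_le; omega
  have h1 : (g ^ k) ^ (q - 1) = 1 := by
    apply mul_right_cancel₀ hc0
    rw [← pow_succ, hq, hc, one_mul]
  have h2 : (q + 1) * (q - 1) ∣ k * (q - 1) := by
    rw [← pow_mul] at h1
    exact (Dvd.intro _ hj.symm).trans (hg.dvd_of_pow_eq_one _ h1)
  obtain ⟨m, rfl⟩ := Nat.dvd_of_mul_dvd_mul_right (by have := h.two_le; omega) h2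
  refine ⟨g ^ m, ?_, by rw [← pow_mul, mul_comm]⟩
  have h3 : (g ^ m) ^ (q + 1) = g ^ ((q + 1) * m) := by rw [← pow_mul, mul_comm]
  rw [← h3] at hc
  have h4 : g ^ m ≠ 0 := fun h0 => by
    rw [h0, zero_pow (by omega)] at h3
    exact hc0 h3.symm
  apply mul_right_cancel₀ (pow_ne_zero q h4)
  calc (g ^ m) ^ q ^ 2 * (g ^ m) ^ q = ((g ^ m) ^ (q + 1)) ^ q := by
        ring
    _ = g ^ m * (g ^ m) ^ q := by rw [hc, pow_succ']

theorem card_hermForm_eq_of_ne_zero {c : F} (hc0 : c ≠ 0) (hc : c ^ q = c) :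
    (Finset.univ.filter fun x : F => hermForm q s x = c).card =
      (Finset.univ.filter fun x : F => hermForm q s x = 1).card := by
  obtain ⟨a, ha, hac⟩ := h.exists_norm_eq hc0 hc
  have ha0 : a ≠ 0 := by
    rintro rfl
    exact hc0 (by rw [← hac, zero_pow (by omega)])
  refine (Finset.card_equiv (Equiv.mulLeft₀ a ha0) fun x => ?_).symm
  simp [hermForm_mul ha, hac, hc0]

theorem card_pow_eq_one : (Finset.univ.filter fun z : F => z ^ (q + 1) = 1).card = q + 1 := by
  obtain ⟨g, hg, -⟩ := h.exists_generator
  obtain ⟨j, hj⟩ := exists_pow_sub_one_eq (q := q) (s := s)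
  have := (hg.pow h.pow_sub_one_pos (a := (q - 1) * j) (b := q + 1)
    (by rw [hj]; ring)).card_nthRootsFinset
  conv_rhs => rw [← this]
  congr 1
  ext z
  simp [Polynomial.mem_nthRootsFinset]

omit h [Fintype F] [DecidableEq F] in
theorem hermForm_eq_of_pow_eq {x y : F} (hxy : x ^ (q + 1) = y ^ (q + 1)) :
    hermForm q s x = hermForm q s y := by
  obtain ⟨k, hk⟩ : q + 1 ∣ q ^ (2 * s + 1) + 1 := by
    simpa using Odd.nat_add_dvd_pow_add_pow q 1 (n := 2 * s + 1) ⟨s, rfl⟩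
  rw [hermForm, hermForm, ← pow_succ, ← pow_succ, hk, pow_mul, pow_mul, hxy]

theorem dvd_card_hermForm_eq_one :
    q + 1 ∣ (Finset.univ.filter fun x : F => hermForm q s x = 1).card := by
  rw [Finset.card_eq_sum_card_image (fun x : F => x ^ (q + 1))]
  refine Finset.dvd_sum fun b hb => ?_
  obtain ⟨y, hy, rfl⟩ := Finset.mem_image.1 hb
  have hy1 : hermForm q s y = 1 := (Finset.mem_filter.1 hy).2
  have hy0 : y ≠ 0 := by
    rintro rfl
    rw [hermForm, mul_zero, h.trace_zero] at hy1
    exact zero_ne_one hy1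
  conv_lhs => rw [← h.card_pow_eq_one (F := F)]
  refine dvd_of_eq (Finset.card_equiv (Equiv.mulRight₀ y hy0) fun z => ?_)
  simp only [Finset.mem_filter, Finset.mem_univ, true_and, Equiv.mulRight₀_apply, mul_pow,
    mul_eq_right₀ (pow_ne_zero (q + 1) hy0)]
  refine ⟨fun hz => ⟨?_, hz⟩, fun hz => hz.2⟩
  rw [hermForm_eq_of_pow_eq (y := y) (by rw [mul_pow, hz, one_mul]), hy1]

theorem card_shift (w : F) :
    (Finset.univ.filter fun x : F => hermForm q s (w + x) = hermForm q s x).card =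
      if w ^ q ^ 2 + w = 0 then q ^ (4 * s) else q ^ (4 * s - 1) := by
  have hiff : ∀ x : F, hermForm q s (w + x) = hermForm q s x ↔
      fieldTrace q s (x ^ q ^ (2 * s + 1) * (w ^ q ^ 2 + w)) = -hermForm q s w := fun x => by
    rw [h.hermForm_add]
    constructor <;> intro h' <;> linear_combination h'
  simp only [hiff]
  split_ifs with hw
  · rw [hw, h.hermForm_radical hw]
    simp [h.trace_zero, h.card]
  · have hc : (-hermForm q s w) ^ q = -hermForm q s w := by
      simpa [h.hermForm_pow_eq] using h.neg_pow_pow 1 (hermForm q s w)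
    rw [← h.card_trace_mul_eq hw hc]
    have hbij : Function.Bijective fun x : F => x ^ q ^ (2 * s + 1) := by
      refine Finite.injective_iff_bijective.1 ?_
      intro x y hxy
      have := congrArg (· ^ q ^ (2 * s - 1)) hxy
      simpa only [pow_pow_pow, show 2 * s + 1 + (2 * s - 1) = 4 * s by have := h.pos; omega,
        h.pow_card] using this
    refine Finset.card_equiv (Equiv.ofBijective _ hbij) fun x => ?_
    simp

theorem sum_card_sq :
    ∑ c ∈ Finset.univ.filter (fun c : F => c ^ q = c),
      (Finset.univ.filter fun x : F => hermForm q s x = c).card ^ 2 =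
    q ^ 2 * q ^ (4 * s) + (q ^ (4 * s) - q ^ 2) * q ^ (4 * s - 1) := by
  have h1 : ∑ c ∈ Finset.univ.filter (fun c : F => c ^ q = c),
      (Finset.univ.filter fun x : F => hermForm q s x = c).card ^ 2 =
      ∑ y : F, (Finset.univ.filter fun x : F => hermForm q s x = hermForm q s y).card := by
    rw [← Finset.sum_fiberwise_of_maps_to (s := Finset.univ) (g := hermForm q s)
      (t := Finset.univ.filter (fun c : F => c ^ q = c)) fun x _ => by simp [h.hermForm_pow_eq]]
    refine Finset.sum_congr rfl fun c _ => ?_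
    rw [Finset.sum_congr rfl fun y hy => by rw [(Finset.mem_filter.1 hy).2], Finset.sum_const,
      smul_eq_mul, sq]
  have h2 : ∀ y : F, (Finset.univ.filter fun x : F => hermForm q s x = hermForm q s y).card =
      (Finset.univ.filter fun w : F => hermForm q s (w + y) = hermForm q s y).card := fun y => by
    refine (Finset.card_equiv (Equiv.addRight y) fun x => ?_).symm
    simp
  rw [h1, Finset.sum_congr rfl fun y _ => h2 y]
  simp only [Finset.card_filter]
  rw [Finset.sum_comm]
  simp only [← Finset.card_filter, h.card_shift]
  rw [Finset.sum_ite, Finset.sum_const, Finset.sum_const, h.card_radical, smul_eq_mul, smul_eq_mul]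
  congr 2
  have := Finset.card_filter_add_card_filter_not (s := (Finset.univ : Finset F))
    (fun w : F => w ^ q ^ 2 + w = 0)
  rw [h.card_radical, Finset.card_univ, h.card] at this
  omega

/-- The form has elliptic type: its value distribution. -/
theorem card_hermForm :
    (Finset.univ.filter fun x : F => hermForm q s x = 1).card = q ^ (4 * s - 1) + q ^ (2 * s) ∧
    (Finset.univ.filter fun x : F => hermForm q s x = 0).card ≤ q ^ (4 * s - 1) + q ^ (2 * s) := by
  set N := (Finset.univ.filter fun x : F => hermForm q s x = 1).card with hN
  set Z := (Finset.univ.filter fun x : F => hermForm q s x = 0).card with hZ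
  have hq := h.two_le
  have hsplit : ∀ φ : ℕ → ℕ, ∑ c ∈ Finset.univ.filter (fun c : F => c ^ q = c),
      φ (Finset.univ.filter fun x : F => hermForm q s x = c).card = φ Z + (q - 1) * φ N := by
    intro φ
    have h0 : (0 : F) ∈ Finset.univ.filter (fun c : F => c ^ q = c) := by
      simp [zero_pow (show q ≠ 0 by omega)]
    rw [← Finset.add_sum_erase _ _ h0, Finset.sum_congr rfl fun c hc => by
      rw [h.card_hermForm_eq_of_ne_zero (Finset.mem_erase.1 hc).1
        (Finset.mem_filter.1 (Finset.mem_erase.1 hc).2).2], Finset.sum_const,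
      Finset.card_erase_of_mem h0, h.card_fixed, smul_eq_mul]
  have e1 : Z + (q - 1) * N = q ^ (4 * s) :=
    (hsplit id).symm.trans (h.sum_fibers _ h.hermForm_pow_eq)
  have e2 : Z ^ 2 + (q - 1) * N ^ 2 =
      q ^ 2 * q ^ (4 * s) + (q ^ (4 * s) - q ^ 2) * q ^ (4 * s - 1) :=
    (hsplit (· ^ 2)).symm.trans h.sum_card_sq
  have hd : q + 1 ∣ N := h.dvd_card_hermForm_eq_one
  have hle : q ^ 2 ≤ q ^ (4 * s) :=
    Nat.pow_le_pow_right (by omega) (by have := h.pos; omega)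
  have hM := h.pow_succ_pred
  have hR : q ^ (4 * s) = (q ^ (2 * s)) ^ 2 := by
    rw [← pow_mul]
    ring_nf
  have hdvd1 : ((q : ℤ) + 1) ∣ (q : ℤ) ^ (4 * s - 1) + 1 := by
    simpa using Odd.add_dvd_pow_add_pow (q : ℤ) 1 (n := 4 * s - 1)
      ⟨2 * s - 1, by have := h.pos; omega⟩
  have hdvd2 : ((q : ℤ) + 1) ∣ (q : ℤ) ^ (2 * s) - 1 := by
    have h1 : ((q : ℤ) + 1) ∣ (q : ℤ) ^ 2 - 1 := ⟨q - 1, by ring⟩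
    rw [pow_mul]
    exact h1.trans (by simpa using sub_dvd_pow_sub_pow ((q : ℤ) ^ 2) 1 s)
  have hdN : ((q : ℤ) + 1) ∣ (N : ℤ) := by exact_mod_cast hd
  have hRpos : 0 < q ^ (2 * s) := by positivity
  zify [hle, show 1 ≤ q by omega] at e1 e2 hM hR hq hRpos ⊢
  generalize (q : ℤ) ^ (4 * s - 1) = M at *
  generalize (q : ℤ) ^ (2 * s) = R at *
  generalize (q : ℤ) ^ (4 * s) = P at *
  subst hR
  have hS : ((q : ℤ) - 1) * (((Z : ℤ) - N - q * R) * (Z - N + q * R)) = 0 := by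
    linear_combination (q : ℤ) * e2 - (Z + (q - 1) * N + R ^ 2) * e1 + (R ^ 2 - q ^ 2) * hM
  have hq0 : (q : ℤ) ≠ 0 := by omega
  rcases mul_eq_zero.1 ((mul_eq_zero.1 hS).resolve_left (by omega)) with h1 | h1
  · exfalso
    have hNv : (N : ℤ) = M - R := by
      apply mul_left_cancel₀ hq0
      linear_combination e1 - hM - h1
    have h2 : ((q : ℤ) + 1) ∣ 2 := by
      have := (hdvd1.sub hdvd2).sub hdN
      rwa [hNv, show M + 1 - (R - 1) - (M - R) = 2 by ring] at this
    have := Int.le_of_dvd two_pos h2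
    omega
  · have hNv : (N : ℤ) = M + R := by
      apply mul_left_cancel₀ hq0
      linear_combination e1 - hM - h1
    exact ⟨hNv, by nlinarith⟩

theorem card_hermForm_eq_le {c : F} (hc : c ^ q = c) :
    (Finset.univ.filter fun x : F => hermForm q s x = c).card ≤ q ^ (4 * s - 1) + q ^ (2 * s) := by
  by_cases hc0 : c = 0
  · rw [hc0]
    exact h.card_hermForm.2
  · rw [h.card_hermForm_eq_of_ne_zero hc0 hc, h.card_hermForm.1]

end IsFourfoldExtension

section Plane

variable {F : Type*} [Field F]

/-- The point `(x : y : 1)`. -/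
def affinePoint (x y : F) : Projectivization F (Fin 3 → F) :=
  Projectivization.mk F ![x, y, 1] (fun h => one_ne_zero (congrFun h 2))

/-- The point `(1 : B : 0)`. -/
def infinitePoint (B : F) : Projectivization F (Fin 3 → F) :=
  Projectivization.mk F ![1, B, 0] (fun h => one_ne_zero (congrFun h 0))

variable (F) in
/-- The point `(0 : 1 : 0)`. -/
def verticalPoint : Projectivization F (Fin 3 → F) :=
  Projectivization.mk F ![0, 1, 0] (fun h => one_ne_zero (congrFun h 1))

/-- The line `α X + β Y + γ Z = 0`. -/
def projLine (α β γ : F) : Set (Projectivization F (Fin 3 → F)) :=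
  {P | α * P.rep 0 + β * P.rep 1 + γ * P.rep 2 = 0}

theorem mk_mem_projLine {α β γ : F} {v : Fin 3 → F} (hv : v ≠ 0) :
    Projectivization.mk F v hv ∈ projLine α β γ ↔ α * v 0 + β * v 1 + γ * v 2 = 0 := by
  obtain ⟨a, ha⟩ := Projectivization.exists_smul_eq_mk_rep F v hv
  have h : ∀ i, (Projectivization.mk F v hv).rep i = (a : F) * v i := fun i => by
    rw [← ha]
    rfl
  simp only [projLine, Set.mem_ofPred_eq, h]
  rw [show α * (a * v 0) + β * (a * v 1) + γ * (a * v 2) =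
    a * (α * v 0 + β * v 1 + γ * v 2) by ring]
  simp

theorem affinePoint_mem_projLine {α β γ x y : F} :
    affinePoint x y ∈ projLine α β γ ↔ α * x + β * y + γ = 0 := by
  simp [affinePoint, mk_mem_projLine]

theorem infinitePoint_mem_projLine {α β γ B : F} :
    infinitePoint B ∈ projLine α β γ ↔ α + β * B = 0 := by
  simp [infinitePoint, mk_mem_projLine]

theorem verticalPoint_mem_projLine {α β γ : F} : verticalPoint F ∈ projLine α β γ ↔ β = 0 := by
  simp [verticalPoint, mk_mem_projLine]

theorem affinePoint_inj {x y x' y' : F} :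
    affinePoint x y = affinePoint x' y' ↔ x = x' ∧ y = y' := by
  refine ⟨fun h => ?_, fun h => by rw [h.1, h.2]⟩
  have h1 := (affinePoint_mem_projLine (α := 1) (β := 0) (γ := -x') (x := x) (y := y)).1
    (by rw [h, affinePoint_mem_projLine]; ring)
  have h2 := (affinePoint_mem_projLine (α := 0) (β := 1) (γ := -y') (x := x) (y := y)).1
    (by rw [h, affinePoint_mem_projLine]; ring)
  constructor
  · linear_combination h1
  · linear_combination h2

theorem infinitePoint_inj {B B' : F} : infinitePoint B = infinitePoint B' ↔ B = B' := by
  refine ⟨fun h => ?_, fun h => by rw [h]⟩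
  have h1 := (infinitePoint_mem_projLine (α := -B') (β := 1) (γ := 0) (B := B)).1
    (by rw [h, infinitePoint_mem_projLine]; ring)
  linear_combination h1

theorem infinitePoint_ne_affinePoint {B x y : F} : infinitePoint B ≠ affinePoint x y := fun h => by
  have h1 := (affinePoint_mem_projLine (α := 0) (β := 0) (γ := 1) (x := x) (y := y)).1
    (by rw [← h, infinitePoint_mem_projLine]; ring)
  simp at h1

theorem verticalPoint_ne_affinePoint {x y : F} : verticalPoint F ≠ affinePoint x y := fun h => by
  have h1 := (affinePoint_mem_projLine (α := 0) (β := 0) (γ := 1) (x := x) (y := y)).1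
    (by rw [← h, verticalPoint_mem_projLine])
  simp at h1

theorem verticalPoint_ne_infinitePoint {B : F} : verticalPoint F ≠ infinitePoint B := fun h => by
  have h1 := (infinitePoint_mem_projLine (α := 1) (β := 0) (γ := 0) (B := B)).1
    (by rw [← h, verticalPoint_mem_projLine])
  simp at h1

theorem exists_eq_point (P : Projectivization F (Fin 3 → F)) :
    (∃ x y, P = affinePoint x y) ∨ (∃ B, P = infinitePoint B) ∨ P = verticalPoint F := by
  induction P using Projectivization.ind with
  | h v hv =>
  by_cases h2 : v 2 = 0
  · by_cases h0 : v 0 = 0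
    · refine Or.inr (Or.inr ((Projectivization.mk_eq_mk_iff' F _ _ _ _).2 ⟨v 1, ?_⟩))
      ext i
      fin_cases i <;> simp [h0, h2]
    · refine Or.inr (Or.inl ⟨v 1 / v 0, (Projectivization.mk_eq_mk_iff' F _ _ _ _).2 ⟨v 0, ?_⟩⟩)
      ext i
      fin_cases i <;> simp [h2, mul_div_cancel₀ _ h0]
  · refine Or.inl ⟨v 0 / v 2, v 1 / v 2, (Projectivization.mk_eq_mk_iff' F _ _ _ _).2 ⟨v 2, ?_⟩⟩
    ext i
    fin_cases i <;> simp [mul_div_cancel₀ _ h2]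

theorem natCard_projective_set [Finite F] (S : Set (Projectivization F (Fin 3 → F))) :
    Nat.card S = Nat.card {p : F × F // affinePoint p.1 p.2 ∈ S} +
      Nat.card {B : F // infinitePoint B ∈ S} + Nat.card {_u : Unit // verticalPoint F ∈ S} := by
  rw [← Nat.card_sum, ← Nat.card_sum]
  let f : ({p : F × F // affinePoint p.1 p.2 ∈ S} ⊕ {B : F // infinitePoint B ∈ S}) ⊕
      {_u : Unit // verticalPoint F ∈ S} → S :=
    Sum.elim (Sum.elim (fun p => ⟨_, p.2⟩) (fun B => ⟨_, B.2⟩)) (fun u => ⟨_, u.2⟩)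
  refine (Nat.card_congr (Equiv.ofBijective f ⟨?_, ?_⟩)).symm
  · rintro ((⟨⟨x, y⟩, hp⟩ | ⟨B, hB⟩) | ⟨u, hu⟩) ((⟨⟨x', y'⟩, hp'⟩ | ⟨B', hB'⟩) | ⟨u', hu'⟩) hf <;>
      have hf' := congrArg Subtype.val hf <;>
      simp only [f, Sum.elim_inl, Sum.elim_inr] at hf'
    · obtain ⟨rfl, rfl⟩ := affinePoint_inj.1 hf'
      rfl
    · exact absurd hf'.symm infinitePoint_ne_affinePoint
    · exact absurd hf'.symm verticalPoint_ne_affinePoint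
    · exact absurd hf' infinitePoint_ne_affinePoint
    · obtain rfl := infinitePoint_inj.1 hf'
      rfl
    · exact absurd hf'.symm verticalPoint_ne_infinitePoint
    · exact absurd hf' verticalPoint_ne_affinePoint
    · exact absurd hf' verticalPoint_ne_infinitePoint
    · rfl
  · rintro ⟨P, hP⟩
    rcases exists_eq_point P with ⟨x, y, rfl⟩ | ⟨B, rfl⟩ | rfl
    · exact ⟨Sum.inl (Sum.inl ⟨(x, y), hP⟩), rfl⟩
    · exact ⟨Sum.inl (Sum.inr ⟨B, hP⟩), rfl⟩
    · exact ⟨Sum.inr ⟨(), hP⟩, rfl⟩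

end Plane

/-- `S` consists of the rational points of the curve `Tr y = Tr (x ^ (q ^ (2 * s + 1) + 1))`
together with the points at infinity whose slope lies in `D`. -/
structure IsExtendedCurve {F : Type*} [Field F] (q s : ℕ) (D : Set F)
    (S : Set (Projectivization F (Fin 3 → F))) : Prop where
  affine : ∀ x y, affinePoint x y ∈ S ↔ fieldTrace q s y = hermForm q s x
  infinite : ∀ B, infinitePoint B ∈ S ↔ B ∈ D
  vertical : verticalPoint F ∈ S

namespace IsExtendedCurve

variable {F : Type*} [Field F] [Fintype F] {q s : ℕ} {D : Set F}
  {S : Set (Projectivization F (Fin 3 → F))}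

theorem natCard_eq (hS : IsExtendedCurve q s D S) (h : IsFourfoldExtension q s F) :
    Nat.card S = q ^ (8 * s - 1) + Nat.card D + 1 := by
  classical
  rw [natCard_projective_set]
  have h1 : Nat.card {p : F × F // affinePoint p.1 p.2 ∈ S} = q ^ (8 * s - 1) := by
    rw [Nat.card_congr (Equiv.subtypeProdEquivSigmaSubtype fun x y => affinePoint x y ∈ S),
      Nat.card_sigma]
    simp only [hS.affine, Nat.card_eq_fintype_card, Fintype.card_subtype]
    rw [Finset.sum_congr rfl fun x _ => h.card_trace_eq (h.hermForm_pow_eq x), Finset.sum_const,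
      Finset.card_univ, h.card, smul_eq_mul, ← pow_add]
    congr 1
    have := h.pos
    omega
  have h2 : Nat.card {B : F // infinitePoint B ∈ S} = Nat.card D :=
    Nat.card_congr (Equiv.subtypeEquivRight hS.infinite)
  rw [h1, h2]
  simp [hS.vertical]

theorem natCard_inter_of_ne_zero [DecidableEq F] (hS : IsExtendedCurve q s D S)
    {α β γ B C : F} (hβ : β ≠ 0) (hα : α = -(β * B)) (hγ : γ = -(β * C)) :
    Nat.card ↥(S ∩ projLine α β γ) =
      (Finset.univ.filter fun x : F => fieldTrace q s (B * x + C) = hermForm q s x).card +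
        Nat.card {B' : F // B' ∈ D ∧ B' = B} := by
  have hy : ∀ x y : F, α * x + β * y + γ = 0 ↔ y = B * x + C := fun x y => by
    rw [hα, hγ, ← sub_eq_zero (a := y), ← mul_right_inj' hβ (b := y - _), mul_zero]
    ring_nf
  have hB : ∀ B', α + β * B' = 0 ↔ B' = B := fun B' => by
    rw [hα, ← sub_eq_zero (a := B'), ← mul_right_inj' hβ (b := B' - _), mul_zero]
    ring_nf
  rw [natCard_projective_set]
  have h3 : Nat.card {_u : Unit // verticalPoint F ∈ S ∩ projLine α β γ} = 0 := by
    simp [verticalPoint_mem_projLine, hβ]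
  rw [h3, add_zero, ← Fintype.card_subtype, ← Nat.card_eq_fintype_card]
  simp only [Set.mem_inter_iff, affinePoint_mem_projLine, infinitePoint_mem_projLine, hS.affine,
    hS.infinite, hy, hB]
  congr 1
  refine Nat.card_congr ⟨fun p => ⟨p.1.1, ?_⟩, fun x => ⟨(x.1, B * x.1 + C), x.2, rfl⟩, ?_, ?_⟩
  · rw [← p.2.2]
    exact p.2.1
  · rintro ⟨⟨x, y⟩, hxy, hp⟩
    simp only at hp
    subst hp
    rfl
  · exact fun _ => rfl

theorem natCard_inter_vertical (hS : IsExtendedCurve q s D S) (h : IsFourfoldExtension q s F)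
    {α γ : F} (hα : α ≠ 0) :
    Nat.card ↥(S ∩ projLine α 0 γ) = q ^ (4 * s - 1) + 1 := by
  classical
  have hx : ∀ x : F, α * x + γ = 0 ↔ x = -γ / α := fun x => by
    rw [eq_div_iff hα, eq_neg_iff_add_eq_zero, mul_comm]
  rw [natCard_projective_set]
  simp only [Set.mem_inter_iff, affinePoint_mem_projLine, infinitePoint_mem_projLine,
    verticalPoint_mem_projLine, hS.affine, hS.infinite, hS.vertical, hx, zero_mul, add_zero, hα,
    and_false, and_true]
  have h1 : Nat.card {p : F × F // fieldTrace q s p.2 = hermForm q s p.1 ∧ p.1 = -γ / α} =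
      q ^ (4 * s - 1) := by
    rw [← h.card_trace_eq (h.hermForm_pow_eq (-γ / α)), ← Fintype.card_subtype,
      ← Nat.card_eq_fintype_card]
    refine Nat.card_congr ⟨fun p => ⟨p.1.2, ?_⟩, fun y => ⟨(-γ / α, y.1), y.2, rfl⟩, ?_, ?_⟩
    · simpa only [p.2.2] using p.2.1
    · rintro ⟨⟨x, y⟩, hxy, hp⟩
      simp only at hp
      subst hp
      rfl
    · exact fun _ => rfl
  rw [h1]
  simp

theorem natCard_inter_infinity (hS : IsExtendedCurve q s D S) {γ : F} (hγ : γ ≠ 0) :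
    Nat.card ↥(S ∩ projLine 0 0 γ) = Nat.card D + 1 := by
  rw [natCard_projective_set]
  simp only [Set.mem_inter_iff, affinePoint_mem_projLine, infinitePoint_mem_projLine,
    verticalPoint_mem_projLine, hS.affine, hS.infinite, hS.vertical, hγ, zero_mul, add_zero,
    zero_add, and_false, and_true]
  simp

variable (hS : IsExtendedCurve q s D S) (h : IsFourfoldExtension q s F)
  (hD : ∀ B ∈ D, ¬∃ u : F, u ^ q ^ 2 + u = B ^ q ^ (2 * s + 1))
include hS h hD

theorem natCard_inter_le (hcard : Nat.card D + 1 = q ^ (4 * s - 1) + q ^ (2 * s)) {α β γ : F}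
    (h0 : (α, β, γ) ≠ (0, 0, 0)) :
    Nat.card ↥(S ∩ projLine α β γ) ≤ q ^ (4 * s - 1) + q ^ (2 * s) := by
  classical
  have hpos : 1 ≤ q ^ (2 * s) := Nat.one_le_pow _ _ (by have := h.two_le; omega)
  by_cases hβ : β = 0
  · subst hβ
    by_cases hα : α = 0
    · subst hα
      rw [hS.natCard_inter_infinity (by simpa using h0), hcard]
    · rw [hS.natCard_inter_vertical h hα]
      omega
  · obtain ⟨B, hB⟩ : ∃ B, α = -(β * B) := ⟨-α / β, by field_simp⟩
    obtain ⟨C, hC⟩ : ∃ C, γ = -(β * C) := ⟨-γ / β, by field_simp⟩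
    rw [hS.natCard_inter_of_ne_zero hβ hB hC]
    by_cases hu : ∃ u : F, u ^ q ^ 2 + u = B ^ q ^ (2 * s + 1)
    · have : IsEmpty {B' : F // B' ∈ D ∧ B' = B} := ⟨fun b => hD b.1 b.2.1 (by rwa [b.2.2])⟩
      obtain ⟨u, hu⟩ := hu
      rw [Nat.card_of_isEmpty, add_zero, h.card_line_of_exists hu]
      exact h.card_hermForm_eq_le (by rw [h.add_pow, h.hermForm_pow_eq, h.trace_pow_eq])
    · have hle : Nat.card {B' : F // B' ∈ D ∧ B' = B} ≤ 1 :=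
        Finite.card_le_one_iff_subsingleton.2
          ⟨fun b b' => Subtype.ext (b.2.2.trans b'.2.2.symm)⟩
      obtain ⟨w, hw, hBw⟩ : ∃ w : F, w ^ q ^ 2 + w = 0 ∧ fieldTrace q s (B * w) ≠ 0 := by
        by_contra! hall
        exact hu (h.exists_of_trace_mul_radical hall)
      rw [h.card_line_of_trace_ne_zero hw hBw]
      omega

theorem exists_natCard_inter_eq (hcard : Nat.card D + 1 = q ^ (4 * s - 1) + q ^ (2 * s))
    {P : Projectivization F (Fin 3 → F)} (hP : P ∉ S) :
    ∃ α β γ : F, (α, β, γ) ≠ (0, 0, 0) ∧ P ∈ projLine α β γ ∧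
      Nat.card ↥(S ∩ projLine α β γ) = q ^ (4 * s - 1) + q ^ (2 * s) := by
  classical
  rcases exists_eq_point P with ⟨a, b, rfl⟩ | ⟨B, rfl⟩ | rfl
  · rw [hS.affine] at hP
    obtain ⟨B, hB⟩ : ∃ B : F, a ^ q ^ 2 + a = B ^ q ^ (2 * s + 1) := by
      refine ⟨(a ^ q ^ 2 + a) ^ q ^ (2 * s - 1), ?_⟩
      rw [IsFourfoldExtension.pow_pow_pow,
        show 2 * s - 1 + (2 * s + 1) = 4 * s by have := h.pos; omega, h.pow_card]
    refine ⟨B, -1, b - B * a, by simp, ?_, ?_⟩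
    · rw [affinePoint_mem_projLine]
      ring
    · have : IsEmpty {B' : F // B' ∈ D ∧ B' = B} :=
        ⟨fun b => hD b.1 b.2.1 ⟨a, by rwa [b.2.2]⟩⟩
      rw [hS.natCard_inter_of_ne_zero (B := B) (C := b - B * a) (by simp) (by ring) (by ring),
        Nat.card_of_isEmpty, add_zero, h.card_line_of_exists hB,
        h.card_hermForm_eq_of_ne_zero _ (by rw [h.add_pow, h.hermForm_pow_eq, h.trace_pow_eq]),
        h.card_hermForm.1]
      have h1 := h.trace_add (b - B * a) (B * a)
      rw [sub_add_cancel, h.trace_mul_self hB] at h1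
      intro h2
      exact hP (by linear_combination h1 + h2)
  · exact ⟨0, 0, 1, by simp, by simp [infinitePoint_mem_projLine], by
      rw [hS.natCard_inter_infinity one_ne_zero, hcard]⟩
  · exact absurd hS.vertical hP

end IsExtendedCurve

/-- Let `p` be prime, `q = p ^ n`, `ℓ ≥ 4` with `ℓ ≡ 0 (mod 4)` and
`r = ℓ/2 + 1`.  Let `K` be the set of rational points of the generalized Hermitian curve
and `H = {B : x^(q^(2r)) + x = B^(q^r)` is solvable`}`.  For every `H₁ ⊆ F_{q^ℓ} ∖ H` of
size `q^(ℓ-1) + q^(r-1) - 1`, the pointset `K₂ = K ∪ {(1 : B : 0) : B ∈ H₁}` is a complete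
`(N₂, d)`-arc with `N₂ = q^(2ℓ-1) + q^(ℓ-1) + q^(r-1)` and `d = q^(ℓ-1) + q^(r-1)`. -/
theorem stmt_18 (p n : ℕ) (hp : p.Prime) (hn : 1 ≤ n) (q : ℕ) (hq : q = p ^ n)
    (ℓ r : ℕ) (hℓ : 4 ≤ ℓ) (hl4 : ℓ % 4 = 0) (hr : r = ℓ / 2 + 1)
    (F : Type) [Field F] [Fintype F] (hF : Fintype.card F = q ^ ℓ)
    (T : F → F) (hT : ∀ z : F, T z = ∑ i ∈ Finset.range ℓ, z ^ q ^ i)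
    (K : Set (Projectivization F (Fin 3 → F)))
    (hK : K = {P | ∃ x y : F, T y = T (x ^ (q ^ r + 1)) ∧
          P = Projectivization.mk F ![x, y, 1]
            (fun h => one_ne_zero (congrFun h 2))} ∪
        {Projectivization.mk F ![0, 1, 0]
            (fun h => one_ne_zero (congrFun h 1))})
    (H : Set F) (hH : H = {B : F | ∃ x : F, x ^ q ^ (2 * r) + x = B ^ q ^ r}) :
    ∀ H₁ : Set F, H₁ ⊆ Hᶜ → Nat.card ↥H₁ = q ^ (ℓ - 1) + q ^ (r - 1) - 1 →
    ∀ K₂ : Set (Projectivization F (Fin 3 → F)),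
      K₂ = K ∪ {P | ∃ B ∈ H₁, P = Projectivization.mk F ![1, B, 0]
            (fun h => one_ne_zero (congrFun h 0))} →
    Nat.card ↥K₂ = q ^ (2 * ℓ - 1) + q ^ (ℓ - 1) + q ^ (r - 1) ∧
    (∀ α β γ : F, (α, β, γ) ≠ (0, 0, 0) →
      Nat.card ↥(K₂ ∩ {P : Projectivization F (Fin 3 → F) |
          α * P.rep 0 + β * P.rep 1 + γ * P.rep 2 = 0})
        ≤ q ^ (ℓ - 1) + q ^ (r - 1)) ∧
    (∀ P : Projectivization F (Fin 3 → F), P ∉ K₂ → ∃ α β γ : F,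
      (α, β, γ) ≠ (0, 0, 0) ∧ α * P.rep 0 + β * P.rep 1 + γ * P.rep 2 = 0 ∧
      Nat.card ↥(K₂ ∩ {Q : Projectivization F (Fin 3 → F) |
          α * Q.rep 0 + β * Q.rep 1 + γ * Q.rep 2 = 0})
        = q ^ (ℓ - 1) + q ^ (r - 1)) := by
  obtain ⟨s, rfl⟩ : ∃ s, ℓ = 4 * s := ⟨ℓ / 4, by omega⟩
  obtain rfl : r = 2 * s + 1 := by omega
  intro H₁ hH₁ hcard K₂ hK₂
  have : Fact p.Prime := ⟨hp⟩
  have hq2 : 2 ≤ q := by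
    rw [hq]
    exact hp.two_le.trans (Nat.le_self_pow (by omega) p)
  have : CharP F p := by
    refine charP_of_card_eq_prime_pow (f := n * (4 * s)) ?_
    rw [hF, hq, ← pow_mul]
  have h : IsFourfoldExtension q s F :=
    ⟨hq2, by omega, hF, fun x y => by rw [hq, add_pow_char_pow]⟩
  have hT' : ∀ z, T z = fieldTrace q s z := fun z => by simp [hT, fieldTrace, twistedTrace]
  have hS : IsExtendedCurve q s H₁ K₂ := by
    have hmem : ∀ P, P ∈ K₂ ↔ ((∃ x y : F, fieldTrace q s y = hermForm q s x ∧
        P = affinePoint x y) ∨ P = verticalPoint F) ∨ ∃ B ∈ H₁, P = infinitePoint B := fun P => by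
      simp only [hK₂, hK, hT', pow_succ]
      rfl
    refine ⟨fun x y => ?_, fun B => ?_, (hmem _).2 (Or.inl (Or.inr rfl))⟩
    · rw [hmem]
      simp [affinePoint_inj, verticalPoint_ne_affinePoint.symm, infinitePoint_ne_affinePoint.symm]
    · rw [hmem]
      simp [infinitePoint_inj, verticalPoint_ne_infinitePoint.symm, infinitePoint_ne_affinePoint]
  have hD : ∀ B ∈ H₁, ¬∃ u : F, u ^ q ^ 2 + u = B ^ q ^ (2 * s + 1) := by
    rintro B hB ⟨u, hu⟩
    refine hH₁ hB ?_
    rw [hH]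
    refine ⟨u, ?_⟩
    rw [← hu, show 2 * (2 * s + 1) = 4 * s + 2 by ring, ← IsFourfoldExtension.pow_pow_pow,
      h.pow_card]
  have hpos : 1 ≤ q ^ (2 * s) := Nat.one_le_pow _ _ (by omega)
  rw [show 2 * s + 1 - 1 = 2 * s by omega] at hcard ⊢
  have hcard' : Nat.card H₁ + 1 = q ^ (4 * s - 1) + q ^ (2 * s) := by omega
  refine ⟨?_, fun α β γ h0 => hS.natCard_inter_le h hD hcard' h0,
    fun P hP => hS.exists_natCard_inter_eq h hD hcard' hP⟩
  rw [hS.natCard_eq h, add_assoc, hcard', ← add_assoc, show 2 * (4 * s) - 1 = 8 * s - 1 by omega]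
end
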